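/- arXiv:1611.06019 — 6 statements merged into one kernel-verified Lean document; each statement's English description precedes it below -/
import Mathlib

section
/- Assume J¹_A ≥ 0 and J²_A ≥ 0 for all A ⊆ Λ. Then for all subsets X, Y ⊆ Λ and all β > 0, the classical XY Gibbs expectations satisfy ⟨σ¹_X σ¹_Y⟩ − ⟨σ¹_X⟩⟨σ¹_Y⟩ ≥ 0 and ⟨σ¹_X σ²_Y⟩ − ⟨σ¹_X⟩⟨σ²_Y⟩ ≤ 0. -/
open MeasureTheory Real

/-- The box `[0, 2π]^Λ` of classical XY configurations. -/
def xyBox (Λ : Type*) [Fintype Λ] : Set (Λ → ℝ) :=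
  Set.univ.pi fun _ : Λ => Set.Icc (0 : ℝ) (2 * π)

/-- Classical XY Hamiltonian with many-body couplings `J1, J2` indexed by subsets of `Λ`:
`H(φ) = −Σ_{A⊆Λ} (J¹_A ∏_{x∈A} cos φ_x + J²_A ∏_{x∈A} sin φ_x)`. -/
noncomputable def xyHam {Λ : Type*} [Fintype Λ] (J1 J2 : Finset Λ → ℝ) (φ : Λ → ℝ) : ℝ :=
  - ∑ A : Finset Λ, (J1 A * ∏ x ∈ A, Real.cos (φ x) + J2 A * ∏ x ∈ A, Real.sin (φ x))

/-- Gibbs expectation of a functional `f` for the classical XY model at inverse temperature `β`: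
`⟨f⟩ = Z⁻¹ ∫_{[0,2π]^Λ} f(φ) e^{−βH(φ)} ∏ dφ_x/(2π)` (the normalisations `1/(2π)` cancel in
the ratio). -/
noncomputable def xyGibbs {Λ : Type*} [Fintype Λ] (J1 J2 : Finset Λ → ℝ) (β : ℝ)
    (f : (Λ → ℝ) → ℝ) : ℝ :=
  (∫ φ in xyBox Λ, f φ * Real.exp (-β * xyHam J1 J2 φ)) /
  (∫ φ in xyBox Λ, Real.exp (-β * xyHam J1 J2 φ))

/-- `σ¹_X = ∏_{x∈X} cos φ_x`. -/
noncomputable def sigma1 {Λ : Type*} (X : Finset Λ) (φ : Λ → ℝ) : ℝ :=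
  ∏ x ∈ X, Real.cos (φ x)

/-- `σ²_X = ∏_{x∈X} sin φ_x`. -/
noncomputable def sigma2 {Λ : Type*} (X : Finset Λ) (φ : Λ → ℝ) : ℝ :=
  ∏ x ∈ X, Real.sin (φ x)

open Set in
/-- Lebesgue measure on one period `[0, 2π]`. -/
noncomputable def periodMeasure : Measure ℝ := volume.restrict (Icc 0 (2 * π))

instance : IsFiniteMeasure periodMeasure := by
  unfold periodMeasure; infer_instance

lemma integral_periodMeasure (f : ℝ → ℝ) :
    ∫ x, f x ∂periodMeasure = ∫ x in (0 : ℝ)..(2 * π), f x := by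
  rw [periodMeasure, integral_Icc_eq_integral_Ioc,
    intervalIntegral.integral_of_le (by positivity)]

lemma volume_restrict_xyBox (Λ : Type*) [Fintype Λ] :
    (volume : Measure (Λ → ℝ)).restrict (xyBox Λ) = Measure.pi fun _ => periodMeasure := by
  simp only [volume_pi, xyBox, Measure.restrict_pi_pi, periodMeasure]

lemma integral_periodMeasure_comp_add {f : ℝ → ℝ} (hf : Function.Periodic f (2 * π)) (c : ℝ) :
    ∫ x, f (x + c) ∂periodMeasure = ∫ x, f x ∂periodMeasure := by
  rw [integral_periodMeasure, integral_periodMeasure, intervalIntegral.integral_comp_add_right,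
    zero_add, add_comm, hf.intervalIntegral_add_eq c 0, zero_add]

lemma integral_periodMeasure_comp_two_mul {f : ℝ → ℝ} (hf : Function.Periodic f (2 * π))
    (hc : Continuous f) :
    ∫ x, f (2 * x) ∂periodMeasure = ∫ x, f x ∂periodMeasure := by
  rw [integral_periodMeasure, integral_periodMeasure,
    intervalIntegral.integral_comp_mul_left _ two_ne_zero, mul_zero, two_mul (2 * π),
    hf.intervalIntegral_add_eq_add 0 (2 * π) (fun _ _ => hc.intervalIntegrable _ _), zero_add,
    smul_eq_mul]
  ring

lemma integral_periodMeasure_comp_neg {f : ℝ → ℝ} (hf : Function.Periodic f (2 * π)) :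
    ∫ x, f (-x) ∂periodMeasure = ∫ x, f x ∂periodMeasure := by
  rw [integral_periodMeasure, integral_periodMeasure, intervalIntegral.integral_comp_neg]
  simpa using hf.intervalIntegral_add_eq (-(2 * π)) 0

lemma integral_cos_pow_mul_sin_pow_nonneg (m n : ℕ) :
    0 ≤ ∫ x, cos x ^ m * sin x ^ n ∂periodMeasure := by
  have hper : Function.Periodic (fun x => cos x ^ m * sin x ^ n) (2 * π) := fun x => by
    simp only [cos_add_two_pi, sin_add_two_pi]
  rcases n.even_or_odd with hn | hn
  · rcases m.even_or_odd with hm | hm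
    · exact integral_nonneg fun x => mul_nonneg (hm.pow_nonneg _) (hn.pow_nonneg _)
    · have h := integral_periodMeasure_comp_add hper π
      simp only [cos_add_pi, sin_add_pi, hm.neg_pow, hn.neg_pow, neg_mul, integral_neg] at h
      linarith
  · have h := integral_periodMeasure_comp_neg hper
    simp only [cos_neg, sin_neg, hn.neg_pow, mul_neg, integral_neg] at h
    linarith

/-- A real-valued function that is continuous and bounded. -/
def ContinuousBounded {α : Type*} [TopologicalSpace α] (f : α → ℝ) : Prop :=
  Continuous f ∧ ∃ C, ∀ x, |f x| ≤ C

namespace ContinuousBounded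

variable {α β : Type*} [TopologicalSpace α] [TopologicalSpace β] {f g : α → ℝ}

lemma const (c : ℝ) : ContinuousBounded fun _ : α => c :=
  ⟨continuous_const, |c|, fun _ => le_rfl⟩

lemma add (hf : ContinuousBounded f) (hg : ContinuousBounded g) :
    ContinuousBounded fun x => f x + g x := by
  obtain ⟨hf, C, hC⟩ := hf
  obtain ⟨hg, D, hD⟩ := hg
  exact ⟨hf.add hg, C + D, fun x => (abs_add_le _ _).trans (add_le_add (hC x) (hD x))⟩

lemma mul (hf : ContinuousBounded f) (hg : ContinuousBounded g) :
    ContinuousBounded fun x => f x * g x := by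
  obtain ⟨hf, C, hC⟩ := hf
  obtain ⟨hg, D, hD⟩ := hg
  refine ⟨hf.mul hg, C * D, fun x => ?_⟩
  rw [abs_mul]
  exact mul_le_mul (hC x) (hD x) (abs_nonneg _) ((abs_nonneg _).trans (hC x))

lemma neg (hf : ContinuousBounded f) : ContinuousBounded fun x => -f x :=
  ⟨hf.1.neg, hf.2.imp fun C hC x => by rw [abs_neg]; exact hC x⟩

lemma abs (hf : ContinuousBounded f) : ContinuousBounded fun x => |f x| :=
  ⟨hf.1.abs, hf.2.imp fun C hC x => by rw [abs_abs]; exact hC x⟩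

lemma exp (hf : ContinuousBounded f) : ContinuousBounded fun x => Real.exp (f x) := by
  obtain ⟨hf, C, hC⟩ := hf
  refine ⟨hf.rexp, Real.exp C, fun x => ?_⟩
  rw [abs_of_pos (exp_pos _)]
  exact exp_le_exp.2 ((le_abs_self _).trans (hC x))

lemma pow (hf : ContinuousBounded f) (n : ℕ) : ContinuousBounded fun x => f x ^ n := by
  induction n with
  | zero => simpa using const (α := α) 1
  | succ n ih => simpa only [pow_succ] using ih.mul hf

lemma prod {ι : Type*} {f : ι → α → ℝ} (s : Finset ι) (hf : ∀ i, ContinuousBounded (f i)) :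
    ContinuousBounded fun x => ∏ i ∈ s, f i x := by
  induction s using Finset.cons_induction with
  | empty => simpa using const (α := α) 1
  | cons i s hi ih => simpa only [Finset.prod_cons] using (hf i).mul ih

lemma sum {ι : Type*} {f : ι → α → ℝ} (s : Finset ι) (hf : ∀ i, ContinuousBounded (f i)) :
    ContinuousBounded fun x => ∑ i ∈ s, f i x := by
  induction s using Finset.cons_induction with
  | empty => simpa using const (α := α) 0
  | cons i s hi ih => simpa only [Finset.sum_cons] using (hf i).add ih

lemma comp (hf : ContinuousBounded f) {h : β → α} (hh : Continuous h) :
    ContinuousBounded fun x => f (h x) :=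
  ⟨hf.1.comp hh, hf.2.imp fun _ hC x => hC (h x)⟩

lemma integrable [MeasurableSpace α] [OpensMeasurableSpace α] {μ : Measure α} [IsFiniteMeasure μ]
    (hf : ContinuousBounded f) : Integrable f μ := by
  obtain ⟨hf, C, hC⟩ := hf
  exact Integrable.of_bound hf.measurable.aestronglyMeasurable C (ae_of_all _ hC)

end ContinuousBounded

lemma ContinuousBounded.cos : ContinuousBounded Real.cos :=
  ⟨continuous_cos, 1, abs_cos_le_one⟩

lemma ContinuousBounded.sin : ContinuousBounded Real.sin :=
  ⟨continuous_sin, 1, abs_sin_le_one⟩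

lemma integral_prod_comp_add_sub {F : ℝ × ℝ → ℝ} (hF : ContinuousBounded F)
    (h₁ : ∀ x y, F (x + 2 * π, y) = F (x, y)) (h₂ : ∀ x y, F (x, y + 2 * π) = F (x, y)) :
    ∫ z, F (z.1 + z.2, z.1 - z.2) ∂periodMeasure.prod periodMeasure =
      ∫ z, F z ∂periodMeasure.prod periodMeasure := by
  have hshear : ContinuousBounded fun z : ℝ × ℝ => F (z.1 + 2 * z.2, z.1) :=
    hF.comp (by fun_prop)
  calc
    _ = ∫ d, ∫ s, F (s + d, s - d) ∂periodMeasure ∂periodMeasure :=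
        integral_prod_symm _ (hF.comp (by fun_prop : Continuous fun z : ℝ × ℝ =>
          (z.1 + z.2, z.1 - z.2))).integrable
    _ = ∫ d, ∫ s, F (s + 2 * d, s) ∂periodMeasure ∂periodMeasure := by
        refine integral_congr_ae (ae_of_all _ fun d => ?_)
        have hper : Function.Periodic (fun s => F (s + d, s - d)) (2 * π) := fun s => by
          simp only [add_right_comm s, add_sub_right_comm s, h₁, h₂]
        simpa [add_assoc, two_mul] using (integral_periodMeasure_comp_add hper d).symm
    _ = ∫ s, ∫ d, F (s + 2 * d, s) ∂periodMeasure ∂periodMeasure := by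
        rw [← integral_prod_symm _ hshear.integrable, ← integral_prod _ hshear.integrable]
    _ = ∫ s, ∫ x, F (x, s) ∂periodMeasure ∂periodMeasure := by
        refine integral_congr_ae (ae_of_all _ fun s => ?_)
        have hper : Function.Periodic (fun x => F (x, s)) (2 * π) := fun x => h₁ x s
        have hper' : Function.Periodic (fun x => F (s + x, s)) (2 * π) := fun x => by
          simp only [← add_assoc, h₁]
        have hcont : Continuous fun x => F (s + x, s) := hF.1.comp (by fun_prop)
        exact (integral_periodMeasure_comp_two_mul hper' hcont).trans
          (by simpa only [add_comm s] using integral_periodMeasure_comp_add hper s)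
    _ = _ := (integral_prod_symm _ hF.integrable).symm

/-- Half sums and half differences of the cosines and of the sines of two angles. -/
noncomputable def halfCombination (p : ℝ × ℝ) : Fin 4 → ℝ :=
  ![(cos p.2 + cos p.1) / 2, (cos p.2 - cos p.1) / 2,
    (sin p.1 + sin p.2) / 2, (sin p.1 - sin p.2) / 2]

lemma continuousBounded_halfCombination (j : Fin 4) :
    ContinuousBounded fun p => halfCombination p j := by
  have hc₁ : ContinuousBounded fun p : ℝ × ℝ => cos p.1 := .comp .cos continuous_fst
  have hc₂ : ContinuousBounded fun p : ℝ × ℝ => cos p.2 := .comp .cos continuous_snd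
  have hs₁ : ContinuousBounded fun p : ℝ × ℝ => sin p.1 := .comp .sin continuous_fst
  have hs₂ : ContinuousBounded fun p : ℝ × ℝ => sin p.2 := .comp .sin continuous_snd
  fin_cases j
  · exact (hc₂.add hc₁).mul (.const 2⁻¹)
  · exact (hc₂.add hc₁.neg).mul (.const 2⁻¹)
  · exact (hs₁.add hs₂).mul (.const 2⁻¹)
  · exact (hs₁.add hs₂.neg).mul (.const 2⁻¹)

lemma integral_prod_halfCombination_pow_nonneg (k : Fin 4 → ℕ) :
    0 ≤ ∫ p, ∏ j, halfCombination p j ^ k j ∂periodMeasure.prod periodMeasure := by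
  rw [← integral_prod_comp_add_sub
    (.prod _ fun j => (continuousBounded_halfCombination j).pow (k j))
    (fun x y => by simp only [halfCombination, cos_add_two_pi, sin_add_two_pi])
    (fun x y => by simp only [halfCombination, cos_add_two_pi, sin_add_two_pi])]
  have hfactor (z : ℝ × ℝ) : ∏ j, halfCombination (z.1 + z.2, z.1 - z.2) j ^ k j =
      (cos z.1 ^ (k 0 + k 3) * sin z.1 ^ (k 1 + k 2)) *
        (cos z.2 ^ (k 0 + k 2) * sin z.2 ^ (k 1 + k 3)) := by
    have e₀ : halfCombination (z.1 + z.2, z.1 - z.2) 0 = cos z.1 * cos z.2 := by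
      simp [halfCombination, cos_add, cos_sub]
    have e₁ : halfCombination (z.1 + z.2, z.1 - z.2) 1 = sin z.1 * sin z.2 := by
      simp [halfCombination, cos_add, cos_sub]
    have e₂ : halfCombination (z.1 + z.2, z.1 - z.2) 2 = sin z.1 * cos z.2 := by
      simp [halfCombination, sin_add, sin_sub]
    have e₃ : halfCombination (z.1 + z.2, z.1 - z.2) 3 = cos z.1 * sin z.2 := by
      simp [halfCombination, sin_add, sin_sub]
    rw [Fin.prod_univ_four, e₀, e₁, e₂, e₃]
    ring
  simp only [hfactor]
  rw [integral_prod_mul (fun s => cos s ^ (k 0 + k 3) * sin s ^ (k 1 + k 2))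
    (fun d => cos d ^ (k 0 + k 2) * sin d ^ (k 1 + k 3))]
  exact mul_nonneg (integral_cos_pow_mul_sin_pow_nonneg _ _)
    (integral_cos_pow_mul_sin_pow_nonneg _ _)

section GinibreCone

variable {Λ : Type*} [Fintype Λ]

/-- Nonnegative multiples of monomials in the half combinations at all sites, as functions of a
pair of configurations. -/
def halfMonomials (Λ : Type*) [Fintype Λ] : Submonoid ((Λ → ℝ) × (Λ → ℝ) → ℝ) where
  carrier := {f | ∃ c : ℝ, 0 ≤ c ∧ ∃ k : Λ → Fin 4 → ℕ,
    f = fun ω => c * ∏ x, ∏ j, halfCombination (ω.1 x, ω.2 x) j ^ k x j}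
  one_mem' := ⟨1, zero_le_one, 0, by ext; simp⟩
  mul_mem' := by
    rintro _ _ ⟨c, hc, k, rfl⟩ ⟨d, hd, l, rfl⟩
    refine ⟨c * d, mul_nonneg hc hd, k + l, ?_⟩
    ext ω
    simp only [Pi.mul_apply, Pi.add_apply, pow_add, Finset.prod_mul_distrib]
    ring

/-- The semiring of polynomials with nonnegative coefficients in the half combinations. -/
def ginibreCone (Λ : Type*) [Fintype Λ] : Subsemiring ((Λ → ℝ) × (Λ → ℝ) → ℝ) :=
  (halfMonomials Λ).subsemiringClosure

lemma mem_ginibreCone_of_mem_halfMonomials {f : (Λ → ℝ) × (Λ → ℝ) → ℝ}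
    (hf : f ∈ halfMonomials Λ) : f ∈ ginibreCone Λ :=
  AddSubmonoid.subset_closure hf

lemma const_mem_ginibreCone {c : ℝ} (hc : 0 ≤ c) : (fun _ => c) ∈ ginibreCone Λ :=
  mem_ginibreCone_of_mem_halfMonomials ⟨c, hc, 0, by ext; simp⟩

lemma halfCombination_mem_ginibreCone (x : Λ) (j : Fin 4) :
    (fun ω => halfCombination (ω.1 x, ω.2 x) j) ∈ ginibreCone Λ := by
  classical
  refine mem_ginibreCone_of_mem_halfMonomials
    ⟨1, zero_le_one, fun y i => if y = x then (if i = j then 1 else 0) else 0, ?_⟩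
  ext ω
  rw [Finset.prod_eq_single x (fun y _ hy => by simp [hy]) (by simp),
    Finset.prod_eq_single j (fun i _ hi => by simp [hi]) (by simp)]
  simp

lemma continuousBounded_and_integral_nonneg_of_mem_ginibreCone {f : (Λ → ℝ) × (Λ → ℝ) → ℝ}
    (hf : f ∈ ginibreCone Λ) : ContinuousBounded f ∧
      0 ≤ ∫ ω, f ω ∂((Measure.pi fun _ => periodMeasure).prod
        (Measure.pi fun _ => periodMeasure)) := by
  change f ∈ AddSubmonoid.closure (halfMonomials Λ : Set ((Λ → ℝ) × (Λ → ℝ) → ℝ)) at hf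
  induction hf using AddSubmonoid.closure_induction with
  | mem f hf =>
    obtain ⟨c, hc, k, rfl⟩ := hf
    refine ⟨.mul (.const c) (.prod _ fun x => .prod _ fun j => .pow
      ((continuousBounded_halfCombination j).comp
        (by fun_prop : Continuous fun ω : (Λ → ℝ) × (Λ → ℝ) => (ω.1 x, ω.2 x))) _), ?_⟩
    rw [integral_const_mul, ← (measurePreserving_arrowProdEquivProdArrow ℝ ℝ Λ
      (fun _ => periodMeasure) (fun _ => periodMeasure)).integral_comp']
    refine mul_nonneg hc ?_
    have h := integral_fintype_prod_eq_prod (μ := fun _ : Λ => periodMeasure.prod periodMeasure)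
      fun x p => ∏ j, halfCombination p j ^ k x j
    exact h.symm ▸ Finset.prod_nonneg fun x _ => integral_prod_halfCombination_pow_nonneg (k x)
  | zero => exact ⟨.const 0, by simp⟩
  | add f g _ _ hf hg =>
    refine ⟨hf.1.add hg.1, ?_⟩
    simp only [Pi.add_apply]
    rw [integral_add hf.1.integrable hg.1.integrable]
    exact add_nonneg hf.2 hg.2

lemma integral_mul_exp_nonneg_of_mem_ginibreCone {f g : (Λ → ℝ) × (Λ → ℝ) → ℝ}
    (hf : f ∈ ginibreCone Λ) (hg : g ∈ ginibreCone Λ) :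
    0 ≤ ∫ ω, f ω * exp (g ω) ∂((Measure.pi fun _ => periodMeasure).prod
        (Measure.pi fun _ => periodMeasure)) := by
  have hpartial (n : ℕ) :
      (fun ω => f ω * ∑ i ∈ Finset.range n, g ω ^ i / i.factorial) ∈ ginibreCone Λ := by
    have hsum : (f * ∑ i ∈ Finset.range n, g ^ i * fun _ => (i.factorial : ℝ)⁻¹) ∈
        ginibreCone Λ :=
      mul_mem hf (sum_mem fun i _ => mul_mem (pow_mem hg i) (const_mem_ginibreCone (by positivity)))
    convert hsum using 1
    ext ω
    simp [div_eq_mul_inv]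
  have hf' := (continuousBounded_and_integral_nonneg_of_mem_ginibreCone hf).1
  have hg' := (continuousBounded_and_integral_nonneg_of_mem_ginibreCone hg).1
  refine ge_of_tendsto' (tendsto_integral_of_dominated_convergence
    (fun ω => |f ω| * exp |g ω|) (fun n => ?_) (hf'.abs.mul hg'.abs.exp).integrable
    (fun n => ae_of_all _ fun ω => ?_) (ae_of_all _ fun ω => ?_))
    fun n => (continuousBounded_and_integral_nonneg_of_mem_ginibreCone (hpartial n)).2
  · exact (continuousBounded_and_integral_nonneg_of_mem_ginibreCone
      (hpartial n)).1.1.measurable.aestronglyMeasurable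
  · rw [norm_mul, norm_eq_abs]
    gcongr
    refine (norm_sum_le _ _).trans ?_
    simpa using sum_le_exp_of_nonneg (abs_nonneg (g ω)) n
  · refine Filter.Tendsto.const_mul _ ?_
    rw [exp_eq_exp_ℝ]
    exact (NormedSpace.expSeries_div_hasSum_exp (g ω)).tendsto_sum_nat

lemma prod_add_add_prod_sub_mem_and_sub_mem {ι R : Type*} [CommRing R] (S : Subsemiring R)
    {u v : ι → R} (hu : ∀ i, u i ∈ S) (hv : ∀ i, v i ∈ S) (s : Finset ι) :
    ∏ i ∈ s, (u i + v i) + ∏ i ∈ s, (u i - v i) ∈ S ∧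
      ∏ i ∈ s, (u i + v i) - ∏ i ∈ s, (u i - v i) ∈ S := by
  induction s using Finset.cons_induction with
  | empty => simpa using add_mem (one_mem S) (one_mem S)
  | cons i s hi ih =>
    simp only [Finset.prod_cons]
    constructor
    · convert add_mem (mul_mem (hu i) ih.1) (mul_mem (hv i) ih.2) using 1
      ring
    · convert add_mem (mul_mem (hu i) ih.2) (mul_mem (hv i) ih.1) using 1
      ring

lemma sigma1_mem_ginibreCone (A : Finset Λ) :
    (fun ω => sigma1 A ω.1 + sigma1 A ω.2) ∈ ginibreCone Λ ∧
      (fun ω => sigma1 A ω.2 - sigma1 A ω.1) ∈ ginibreCone Λ := by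
  convert! prod_add_add_prod_sub_mem_and_sub_mem (ginibreCone Λ)
    (fun x => halfCombination_mem_ginibreCone x 0) (fun x => halfCombination_mem_ginibreCone x 1)
    A using 2 <;>
  · ext ω
    simp [sigma1, halfCombination]
    ring_nf

lemma sigma2_mem_ginibreCone (A : Finset Λ) :
    (fun ω => sigma2 A ω.1 + sigma2 A ω.2) ∈ ginibreCone Λ ∧
      (fun ω => sigma2 A ω.1 - sigma2 A ω.2) ∈ ginibreCone Λ := by
  convert! prod_add_add_prod_sub_mem_and_sub_mem (ginibreCone Λ)
    (fun x => halfCombination_mem_ginibreCone x 2) (fun x => halfCombination_mem_ginibreCone x 3)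
    A using 2 <;>
  · ext ω
    simp [sigma2, halfCombination]
    ring_nf

lemma neg_mul_xyHam_add_mem_ginibreCone {J1 J2 : Finset Λ → ℝ} (hJ1 : ∀ A, 0 ≤ J1 A)
    (hJ2 : ∀ A, 0 ≤ J2 A) {β : ℝ} (hβ : 0 ≤ β) :
    (fun ω => -β * xyHam J1 J2 ω.1 + -β * xyHam J1 J2 ω.2) ∈ ginibreCone Λ := by
  have h := mul_mem (const_mem_ginibreCone (Λ := Λ) hβ) (sum_mem (t := Finset.univ)
    fun (A : Finset Λ) _ => add_mem
      (mul_mem (const_mem_ginibreCone (hJ1 A)) (sigma1_mem_ginibreCone A).1)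
      (mul_mem (const_mem_ginibreCone (hJ2 A)) (sigma2_mem_ginibreCone A).1))
  convert h using 1
  ext ω
  simp only [xyHam, sigma1, sigma2, Pi.mul_apply, Finset.sum_apply, Pi.add_apply, neg_mul_neg,
    ← mul_add, ← Finset.sum_add_distrib]
  congr 1
  exact Finset.sum_congr rfl fun A _ => by ring

end GinibreCone

lemma continuousBounded_sigma1 {Λ : Type*} (A : Finset Λ) : ContinuousBounded (sigma1 A) :=
  .prod A fun x => .comp .cos (continuous_apply x)

lemma continuousBounded_sigma2 {Λ : Type*} (A : Finset Λ) : ContinuousBounded (sigma2 A) :=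
  .prod A fun x => .comp .sin (continuous_apply x)

lemma continuousBounded_exp_neg_mul_xyHam {Λ : Type*} [Fintype Λ] (J1 J2 : Finset Λ → ℝ) (β : ℝ) :
    ContinuousBounded fun φ => exp (-β * xyHam J1 J2 φ) :=
  .exp <| .mul (.const _) <| .neg <| .sum _ fun A =>
    .add (.mul (.const _) (continuousBounded_sigma1 A))
      (.mul (.const _) (continuousBounded_sigma2 A))

/-- The covariance of `f` and `g` under a weight `w`, as an integral over two replicas. -/
lemma integral_prod_sub_mul_sub {α : Type*} [MeasurableSpace α] {μ : Measure α}
    [IsFiniteMeasure μ] {f g w : α → ℝ} (hfgw : Integrable (fun x => f x * g x * w x) μ)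
    (hfw : Integrable (fun x => f x * w x) μ) (hgw : Integrable (fun x => g x * w x) μ)
    (hw : Integrable w μ) :
    ∫ z, (f z.1 - f z.2) * (g z.1 - g z.2) * (w z.1 * w z.2) ∂μ.prod μ =
      2 * ((∫ x, f x * g x * w x ∂μ) * (∫ x, w x ∂μ) -
        (∫ x, f x * w x ∂μ) * (∫ x, g x * w x ∂μ)) := by
  have hexpand (z : α × α) : (f z.1 - f z.2) * (g z.1 - g z.2) * (w z.1 * w z.2) =
      (f z.1 * g z.1 * w z.1) * w z.2 + w z.1 * (f z.2 * g z.2 * w z.2) -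
        ((f z.1 * w z.1) * (g z.2 * w z.2) + (g z.1 * w z.1) * (f z.2 * w z.2)) := by
    ring
  simp only [hexpand]
  have hadd₁ : Integrable (fun z : α × α => (f z.1 * g z.1 * w z.1) * w z.2 +
      w z.1 * (f z.2 * g z.2 * w z.2)) (μ.prod μ) :=
    (hfgw.mul_prod hw).add (hw.mul_prod hfgw)
  have hadd₂ : Integrable (fun z : α × α => (f z.1 * w z.1) * (g z.2 * w z.2) +
      (g z.1 * w z.1) * (f z.2 * w z.2)) (μ.prod μ) :=
    (hfw.mul_prod hgw).add (hgw.mul_prod hfw)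
  rw [integral_sub hadd₁ hadd₂,
    integral_add (hfgw.mul_prod hw) (hw.mul_prod hfgw),
    integral_add (hfw.mul_prod hgw) (hgw.mul_prod hfw),
    integral_prod_mul (fun x => f x * g x * w x) w, integral_prod_mul w (fun x => f x * g x * w x),
    integral_prod_mul (fun x => f x * w x) (fun x => g x * w x),
    integral_prod_mul (fun x => g x * w x) (fun x => f x * w x)]
  ring

/-- The Gibbs covariance is a nonnegative multiple of a two-replica integral. -/
lemma exists_xyGibbs_covariance_eq {Λ : Type*} [Fintype Λ] (J1 J2 : Finset Λ → ℝ) (β : ℝ)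
    {f g : (Λ → ℝ) → ℝ} (hf : ContinuousBounded f) (hg : ContinuousBounded g) :
    ∃ c : ℝ, 0 ≤ c ∧ xyGibbs J1 J2 β (fun φ => f φ * g φ) - xyGibbs J1 J2 β f * xyGibbs J1 J2 β g =
      c * ∫ ω, (f ω.1 - f ω.2) * (g ω.1 - g ω.2) *
        exp (-β * xyHam J1 J2 ω.1 + -β * xyHam J1 J2 ω.2)
        ∂((Measure.pi fun _ => periodMeasure).prod (Measure.pi fun _ => periodMeasure)) := by
  have hw := continuousBounded_exp_neg_mul_xyHam J1 J2 β
  simp only [exp_add]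
  rw [integral_prod_sub_mul_sub (w := fun φ => exp (-β * xyHam J1 J2 φ))
    ((hf.mul hg).mul hw).integrable (hf.mul hw).integrable (hg.mul hw).integrable hw.integrable]
  simp only [xyGibbs, volume_restrict_xyBox]
  set Z := ∫ φ : Λ → ℝ, exp (-β * xyHam J1 J2 φ) ∂Measure.pi fun _ => periodMeasure
  refine ⟨(2 * Z ^ 2)⁻¹, by positivity, ?_⟩
  rcases eq_or_ne Z 0 with hZ | hZ
  · simp [hZ]
  · field_simp

/-- Ginibre inequalities for the classical XY model. -/
theorem classical_xy_ginibre {Λ : Type*} [Fintype Λ] (J1 J2 : Finset Λ → ℝ)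
    (hJ1 : ∀ A : Finset Λ, 0 ≤ J1 A) (hJ2 : ∀ A : Finset Λ, 0 ≤ J2 A)
    (X Y : Finset Λ) (β : ℝ) (hβ : 0 < β) :
    0 ≤ xyGibbs J1 J2 β (fun φ => sigma1 X φ * sigma1 Y φ) -
        xyGibbs J1 J2 β (sigma1 X) * xyGibbs J1 J2 β (sigma1 Y) ∧
    xyGibbs J1 J2 β (fun φ => sigma1 X φ * sigma2 Y φ) -
        xyGibbs J1 J2 β (sigma1 X) * xyGibbs J1 J2 β (sigma2 Y) ≤ 0 := by
  constructor
  · obtain ⟨c, hc, h⟩ := exists_xyGibbs_covariance_eq J1 J2 β (continuousBounded_sigma1 X)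
      (continuousBounded_sigma1 Y)
    rw [h]
    refine mul_nonneg hc ?_
    convert! integral_mul_exp_nonneg_of_mem_ginibreCone
      (mul_mem (sigma1_mem_ginibreCone X).2 (sigma1_mem_ginibreCone Y).2)
      (neg_mul_xyHam_add_mem_ginibreCone hJ1 hJ2 hβ.le) using 4
    simp only [Pi.mul_apply]
    ring
  · obtain ⟨c, hc, h⟩ := exists_xyGibbs_covariance_eq J1 J2 β (continuousBounded_sigma1 X)
      (continuousBounded_sigma2 Y)
    rw [h]
    refine mul_nonpos_of_nonneg_of_nonpos hc ?_
    rw [← neg_nonneg, ← integral_neg]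
    convert! integral_mul_exp_nonneg_of_mem_ginibreCone
      (mul_mem (sigma1_mem_ginibreCone X).2 (sigma2_mem_ginibreCone Y).2)
      (neg_mul_xyHam_add_mem_ginibreCone hJ1 hJ2 hβ.le) using 3
    simp only [Pi.mul_apply]
    ring
end

section
/- Consider the two-body classical XY Hamiltonian H(φ) = −Σ_{x,y∈Λ} J_{xy}(cos φ_x cos φ_y + η_{xy} sin φ_x sin φ_y) with J_{xy} ≥ 0 and |η_{xy}| ≤ 1 for all x,y. Then for every A ⊆ Λ, every pair (x,y) and every β > 0, the Gibbs expectation ⟨∏_{z∈A} cos φ_z⟩ is nondecreasing in the coupling J_{xy}: increasing J_{xy} to J̃_{xy} ≥ J_{xy} (keeping all other couplings and all η fixed) does not decrease ⟨∏_{z∈A} cos φ_z⟩. -/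
open MeasureTheory Real

/-- Two-body classical XY Hamiltonian:
`H(φ) = −Σ_{x,y∈Λ} J_{xy} (cos φ_x cos φ_y + η_{xy} sin φ_x sin φ_y)`. -/
noncomputable def xyHam2 {Λ : Type*} [Fintype Λ] (J η : Λ → Λ → ℝ) (φ : Λ → ℝ) : ℝ :=
  - ∑ x : Λ, ∑ y : Λ,
      J x y * (Real.cos (φ x) * Real.cos (φ y) +
        η x y * (Real.sin (φ x) * Real.sin (φ y)))

/-- Gibbs expectation for the two-body classical XY model at inverse temperature `β`
(the normalisations `1/(2π)` cancel in the ratio). -/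
noncomputable def xyGibbs2 {Λ : Type*} [Fintype Λ] (J η : Λ → Λ → ℝ) (β : ℝ)
    (f : (Λ → ℝ) → ℝ) : ℝ :=
  (∫ φ in xyBox Λ, f φ * Real.exp (-β * xyHam2 J η φ)) /
  (∫ φ in xyBox Λ, Real.exp (-β * xyHam2 J η φ))

/-- The covariance of `F` and `H` for the unnormalised weight `w`, multiplied by the square of
the normalisation. -/
noncomputable def weightedCov {X : Type*} [MeasurableSpace X] (μ : Measure X) (w F H : X → ℝ) : ℝ :=
  (∫ a, w a ∂μ) * (∫ a, F a * H a * w a ∂μ) - (∫ a, F a * w a ∂μ) * ∫ a, H a * w a ∂μ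

theorem weightedCov_comm {X : Type*} [MeasurableSpace X] (μ : Measure X) (w F H : X → ℝ) : weightedCov μ w F H = weightedCov μ w H F := by
  simp only [weightedCov, mul_comm (F _) (H _)]
  ring

section CompactSpace

variable {X : Type*} [TopologicalSpace X] [CompactSpace X] [MeasurableSpace X]
  [OpensMeasurableSpace X] {μ : Measure X} [IsFiniteMeasure μ]

theorem Continuous.integrable_of_compactSpace {f : X → ℝ} (hf : Continuous f) :
    Integrable f μ :=
  hf.integrable_of_hasCompactSupport (HasCompactSupport.of_compactSpace f)

theorem integral_mul_exp_nonneg {g L : X → ℝ} (hg : Continuous g) (hL : Continuous L)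
    (h : ∀ n : ℕ, 0 ≤ ∫ a, g a * L a ^ n ∂μ) : 0 ≤ ∫ a, g a * Real.exp (L a) ∂μ := by
  have hexp (r : ℝ) : HasSum (fun n : ℕ => r ^ n / n.factorial) (Real.exp r) := by
    rw [Real.exp_eq_exp_ℝ]
    exact NormedSpace.expSeries_div_hasSum_exp r
  have hs : HasSum (fun n : ℕ => ∫ a, g a * (L a ^ n / n.factorial) ∂μ)
      (∫ a, g a * Real.exp (L a) ∂μ) := by
    refine hasSum_integral_of_dominated_convergence
      (fun n a => |g a| * (|L a| ^ n / n.factorial)) ?_ ?_ ?_ ?_ ?_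
    · intro n
      exact (Continuous.integrable_of_compactSpace (by fun_prop)).aestronglyMeasurable
    · exact fun n => .of_forall fun a => by simp
    · exact .of_forall fun a => ((hexp _).mul_left _).summable
    · simp_rw [fun a => ((hexp |L a|).mul_left |g a|).tsum_eq]
      exact Continuous.integrable_of_compactSpace (by fun_prop)
    · exact .of_forall fun a => (hexp _).mul_left _
  refine hs.nonneg fun n => ?_
  simp_rw [← mul_div_assoc, integral_div]
  exact div_nonneg (h n) (by positivity)

theorem integral_prod_mul_exp_sum_nonneg [SecondCountableTopology X] {ι : Type*} [Fintype ι]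
    {c : ι → ℝ} (hc : ∀ i, 0 ≤ c i) {f : ι → X → ℝ} (hf : ∀ i, Continuous (f i))
    {g : X → ℝ} (hg : Continuous g) :
    0 ≤ ∫ p, g p.1 * g p.2 * Real.exp (∑ i, c i * (f i p.1 * f i p.2)) ∂μ.prod μ := by
  refine integral_mul_exp_nonneg (by fun_prop) (by fun_prop) fun n => ?_
  induction n generalizing g with
  | zero =>
    simp only [pow_zero, mul_one]
    rw [integral_prod_mul]
    exact mul_self_nonneg _
  | succ n ih =>
    have heq (p : X × X) : g p.1 * g p.2 * (∑ i, c i * (f i p.1 * f i p.2)) ^ (n + 1) =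
        ∑ j, c j * ((g p.1 * f j p.1) * (g p.2 * f j p.2) *
          (∑ i, c i * (f i p.1 * f i p.2)) ^ n) := by
      rw [pow_succ', ← mul_assoc, Finset.mul_sum, Finset.sum_mul]
      exact Finset.sum_congr rfl fun j _ => by ring
    simp_rw [heq]
    rw [integral_finsetSum _ fun j _ => Continuous.integrable_of_compactSpace (by fun_prop)]
    refine Finset.sum_nonneg fun j _ => ?_
    rw [integral_const_mul]
    exact mul_nonneg (hc j) (ih (g := fun a => g a * f j a) (by fun_prop))

theorem weightedCov_eq_integral {w F H : X → ℝ} (hw : Continuous w) (hF : Continuous F)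
    (hH : Continuous H) :
    weightedCov μ w F H =
      ∫ a, ((∫ b, w b ∂μ) * F a - ∫ b, F b * w b ∂μ) * w a * H a ∂μ := by
  rw [weightedCov, ← integral_const_mul, ← integral_const_mul, ← integral_sub
    (Continuous.integrable_of_compactSpace (by fun_prop))
    (Continuous.integrable_of_compactSpace (by fun_prop))]
  exact integral_congr_ae (.of_forall fun a => by simp only; ring)

theorem weightedCov_sum_right {κ : Type*} [Fintype κ] {w F : X → ℝ} {H : κ → X → ℝ}
    (hw : Continuous w) (hF : Continuous F) (hH : ∀ j, Continuous (H j)) (d : κ → ℝ) :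
    weightedCov μ w F (fun a => ∑ j, d j * H j a) = ∑ j, d j * weightedCov μ w F (H j) := by
  simp_rw [weightedCov_eq_integral hw hF (hH _)]
  rw [weightedCov_eq_integral hw hF (by fun_prop)]
  simp_rw [← integral_const_mul]
  rw [← integral_finsetSum _ fun j _ => Continuous.integrable_of_compactSpace (by fun_prop)]
  refine integral_congr_ae (.of_forall fun a => ?_)
  simp only [Finset.mul_sum]
  exact Finset.sum_congr rfl fun j _ => by ring

theorem weightedCov_exp_nonneg {w F V : X → ℝ} (hw : Continuous w) (hF : Continuous F)
    (hV : Continuous V) (h : ∀ n : ℕ, 0 ≤ weightedCov μ w F (fun a => V a ^ n)) :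
    0 ≤ weightedCov μ w F (fun a => Real.exp (V a)) := by
  rw [weightedCov_eq_integral hw hF (by fun_prop)]
  refine integral_mul_exp_nonneg (by fun_prop) hV fun n => ?_
  rw [← weightedCov_eq_integral hw hF (by fun_prop)]
  exact h n

theorem integral_prod_sub_mul_sub_s5 [SecondCountableTopology X] {w F H : X → ℝ}
    (hw : Continuous w) (hF : Continuous F) (hH : Continuous H) :
    ∫ p, (F p.1 - F p.2) * (H p.1 - H p.2) * (w p.1 * w p.2) ∂μ.prod μ =
      2 * weightedCov μ w F H := by
  have heq (p : X × X) : (F p.1 - F p.2) * (H p.1 - H p.2) * (w p.1 * w p.2) =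
      ((F p.1 * H p.1 * w p.1) * w p.2 + w p.1 * (F p.2 * H p.2 * w p.2)) -
      ((F p.1 * w p.1) * (H p.2 * w p.2) + (H p.1 * w p.1) * (F p.2 * w p.2)) := by ring
  simp_rw [heq]
  rw [integral_sub (Continuous.integrable_of_compactSpace (by fun_prop))
      (Continuous.integrable_of_compactSpace (by fun_prop)),
    integral_add (Continuous.integrable_of_compactSpace (by fun_prop))
      (Continuous.integrable_of_compactSpace (by fun_prop)),
    integral_add (Continuous.integrable_of_compactSpace (by fun_prop))
      (Continuous.integrable_of_compactSpace (by fun_prop)),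
    integral_prod_mul (fun a => F a * H a * w a) w, integral_prod_mul w (fun a => F a * H a * w a),
    integral_prod_mul (fun a => F a * w a) (fun a => H a * w a),
    integral_prod_mul (fun a => H a * w a) (fun a => F a * w a), weightedCov]
  ring

end CompactSpace

theorem Real.Angle.cos_sub (a b : Real.Angle) :
    (a - b).cos = a.cos * b.cos + a.sin * b.sin := by
  rw [sub_eq_add_neg, Real.Angle.cos_add, Real.Angle.cos_neg, Real.Angle.sin_neg]
  ring

theorem Real.Angle.cos_mul_cos (a b : Real.Angle) :
    a.cos * b.cos = 1 / 2 * (a + b).cos + 1 / 2 * (a - b).cos := by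
  rw [Real.Angle.cos_add, Real.Angle.cos_sub]
  ring

section Ginibre

variable {G : Type*} [AddCommGroup G] [TopologicalSpace G] [IsTopologicalAddGroup G]
  [CompactSpace G] [SecondCountableTopology G] [MeasurableSpace G] [BorelSpace G]
  {μ : Measure G} [μ.IsAddHaarMeasure]

theorem measurePreserving_add_sub (hG : ∀ g : G, ∃ h, h + h = g) :
    MeasurePreserving (fun p : G × G => (p.1 + p.2, p.1 - p.2)) (μ.prod μ) (μ.prod μ) := by
  let T : G × G →+ G × G :=
    (AddMonoidHom.fst G G + AddMonoidHom.snd G G).prod (AddMonoidHom.fst G G - AddMonoidHom.snd G G)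
  have hT : Continuous T :=
    (continuous_fst.add continuous_snd).prodMk (continuous_fst.sub continuous_snd)
  refine AddMonoidHom.measurePreserving (f := T) hT ?_ rfl
  rintro ⟨u, v⟩
  obtain ⟨a, ha⟩ := hG (u + v)
  refine ⟨(a, u - a), Prod.ext ?_ ?_⟩
  · change a + (u - a) = u
    abel
  · change a - (u - a) = v
    rw [sub_sub_eq_add_sub, ha, add_sub_cancel_left]

variable {ι : Type*} [Fintype ι] {c : ι → ℝ} {e : ι → G →+ Real.Angle}

/-- Ginibre's inequality for a pair of characters. -/
theorem weightedCov_cos_cos_nonneg (hG : ∀ g : G, ∃ h, h + h = g) (hc : ∀ i, 0 ≤ c i)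
    (he : ∀ i, Continuous (e i)) {χ ψ : G →+ Real.Angle} (hχ : Continuous χ) (hψ : Continuous ψ) :
    0 ≤ weightedCov μ (fun g => Real.exp (∑ i, c i * (e i g).cos))
      (fun g => (χ g).cos) (fun g => (ψ g).cos) := by
  have hcos := Real.Angle.continuous_cos
  have hsin := Real.Angle.continuous_sin
  have hT := measurePreserving_add_sub (μ := μ) hG
  have hcov := integral_prod_sub_mul_sub_s5 (μ := μ)
    (w := fun g => Real.exp (∑ i, c i * (e i g).cos)) (F := fun g => (χ g).cos)
    (H := fun g => (ψ g).cos) (by fun_prop) (by fun_prop) (by fun_prop)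
  rw [← hT.map_eq, integral_map hT.measurable.aemeasurable (by
    rw [hT.map_eq]
    exact (Continuous.integrable_of_compactSpace (by fun_prop)).aestronglyMeasurable)] at hcov
  have hpos := integral_prod_mul_exp_sum_nonneg (μ := μ) (c := fun i => 2 * c i)
    (fun i => mul_nonneg zero_le_two (hc i)) (f := fun i g => (e i g).cos) (by fun_prop)
    (g := fun g => 2 * ((χ g).sin * (ψ g).sin)) (by fun_prop)
  refine nonneg_of_mul_nonneg_right (a := 2) ?_ two_pos
  rw [← hcov]
  refine hpos.trans_eq (integral_congr_ae (.of_forall fun p => ?_))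
  simp only [map_add, map_sub, Real.Angle.cos_add, Real.Angle.cos_sub, ← Real.exp_add,
    ← Finset.sum_add_distrib]
  congr 1
  · ring
  · exact congrArg _ (Finset.sum_congr rfl fun i _ => by ring)

theorem weightedCov_prod_cos_nonneg (hG : ∀ g : G, ∃ h, h + h = g) (hc : ∀ i, 0 ≤ c i)
    (he : ∀ i, Continuous (e i)) {κ : Type*} (A : Finset κ) {χ : κ → G →+ Real.Angle}
    (hχ : ∀ z, Continuous (χ z)) {θ ψ : G →+ Real.Angle} (hθ : Continuous θ)
    (hψ : Continuous ψ) :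
    0 ≤ weightedCov μ (fun g => Real.exp (∑ i, c i * (e i g).cos))
      (fun g => (∏ z ∈ A, (χ z g).cos) * (θ g).cos) (fun g => (ψ g).cos) := by
  classical
  have hcos := Real.Angle.continuous_cos
  induction A using Finset.induction_on generalizing θ with
  | empty => simpa using weightedCov_cos_cos_nonneg hG hc he hθ hψ
  | insert a A ha ih =>
    have heq : (fun g => (∏ z ∈ insert a A, (χ z g).cos) * (θ g).cos) = fun g =>
        ∑ b : Bool, (1 / 2 : ℝ) *
          ((∏ z ∈ A, (χ z g).cos) * ((bif b then χ a + θ else χ a - θ) g).cos) := by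
      funext g
      rw [Finset.prod_insert ha, mul_right_comm, Real.Angle.cos_mul_cos]
      simp only [Fintype.sum_bool, cond_true, cond_false, AddMonoidHom.add_apply,
        AddMonoidHom.sub_apply]
      ring
    have hb (b : Bool) : Continuous (bif b then χ a + θ else χ a - θ : G →+ Real.Angle) := by
      cases b
      · exact (hχ a).sub hθ
      · exact (hχ a).add hθ
    rw [heq, weightedCov_comm, weightedCov_sum_right (by fun_prop) (by fun_prop) (by fun_prop)]
    refine Finset.sum_nonneg fun b _ => mul_nonneg (by norm_num) ?_
    rw [weightedCov_comm]
    exact ih (hb b)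

theorem weightedCov_prod_cos_exp_nonneg (hG : ∀ g : G, ∃ h, h + h = g) (hc : ∀ i, 0 ≤ c i)
    (he : ∀ i, Continuous (e i)) {κ : Type*} (A : Finset κ) {χ : κ → G →+ Real.Angle}
    (hχ : ∀ z, Continuous (χ z)) {ρ : Type*} [Fintype ρ] {d : ρ → ℝ} (hd : ∀ j, 0 ≤ d j)
    {ψ : ρ → G →+ Real.Angle} (hψ : ∀ j, Continuous (ψ j)) :
    0 ≤ weightedCov μ (fun g => Real.exp (∑ i, c i * (e i g).cos))
      (fun g => ∏ z ∈ A, (χ z g).cos) (fun g => Real.exp (∑ j, d j * (ψ j g).cos)) := by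
  have hcos := Real.Angle.continuous_cos
  refine weightedCov_exp_nonneg (by fun_prop) (by fun_prop) (by fun_prop) fun n => ?_
  suffices H : ∀ θ : G →+ Real.Angle, Continuous θ →
      0 ≤ weightedCov μ (fun g => Real.exp (∑ i, c i * (e i g).cos))
        (fun g => ∏ z ∈ A, (χ z g).cos)
        (fun g => (∑ j, d j * (ψ j g).cos) ^ n * (θ g).cos) by
    simpa using H 0 continuous_const
  induction n with
  | zero =>
    intro θ hθ
    simpa using weightedCov_prod_cos_nonneg (μ := μ) hG hc he A hχ (θ := 0) continuous_const hθ
  | succ n ih =>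
    intro θ hθ
    have heq : (fun g => (∑ j, d j * (ψ j g).cos) ^ (n + 1) * (θ g).cos) = fun g =>
        ∑ q : ρ × Bool, d q.1 / 2 * ((∑ j, d j * (ψ j g).cos) ^ n *
          ((bif q.2 then ψ q.1 + θ else ψ q.1 - θ) g).cos) := by
      funext g
      rw [pow_succ, mul_assoc, Finset.sum_mul, Finset.mul_sum, Fintype.sum_prod_type]
      refine Finset.sum_congr rfl fun j _ => ?_
      rw [mul_assoc (d j), Real.Angle.cos_mul_cos]
      simp only [Fintype.sum_bool, cond_true, cond_false, AddMonoidHom.add_apply,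
        AddMonoidHom.sub_apply]
      ring
    have hb (q : ρ × Bool) :
        Continuous (bif q.2 then ψ q.1 + θ else ψ q.1 - θ : G →+ Real.Angle) := by
      obtain ⟨j, _ | _⟩ := q
      · exact (hψ j).sub hθ
      · exact (hψ j).add hθ
    rw [heq, weightedCov_sum_right (by fun_prop) (by fun_prop) (by fun_prop)]
    exact Finset.sum_nonneg fun q _ => mul_nonneg (div_nonneg (hd _) zero_le_two) (ih _ (hb q))

end Ginibre

section Torus

variable {Λ : Type*}

/-- The circumference `2π` is positive. -/
local instance : Fact (0 < 2 * π) := ⟨Real.two_pi_pos⟩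

/-- The angle at the site `z`, as a character of the torus. -/
noncomputable def torusAngle (z : Λ) : (Λ → AddCircle (2 * π)) →+ Real.Angle where
  toFun g := g z
  map_zero' := rfl
  map_add' _ _ := rfl

theorem continuous_torusAngle (z : Λ) : Continuous (torusAngle z) :=
  continuous_apply z

/-- The characters `φ_x + φ_y` and `φ_x - φ_y` occurring in the two-body Hamiltonian. -/
noncomputable def pairAngle (i : Λ × Λ × Bool) : (Λ → AddCircle (2 * π)) →+ Real.Angle :=
  bif i.2.2 then torusAngle i.1 + torusAngle i.2.1 else torusAngle i.1 - torusAngle i.2.1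

theorem continuous_pairAngle (i : Λ × Λ × Bool) : Continuous (pairAngle i) := by
  obtain ⟨u, v, _ | _⟩ := i
  · exact (continuous_torusAngle u).sub (continuous_torusAngle v)
  · exact (continuous_torusAngle u).add (continuous_torusAngle v)

/-- The coefficient of `cos (φ_x ± φ_y)` in `-β H`. -/
noncomputable def pairCoupling (J η : Λ → Λ → ℝ) (β : ℝ) (i : Λ × Λ × Bool) : ℝ :=
  β * J i.1 i.2.1 * ((1 - bif i.2.2 then η i.1 i.2.1 else -η i.1 i.2.1) / 2)

theorem pairCoupling_nonneg {J η : Λ → Λ → ℝ} {β : ℝ} (hJ : ∀ u v, 0 ≤ J u v)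
    (hη : ∀ u v, |η u v| ≤ 1) (hβ : 0 ≤ β) (i : Λ × Λ × Bool) : 0 ≤ pairCoupling J η β i := by
  obtain ⟨u, v, b⟩ := i
  have h := abs_le.1 (hη u v)
  refine mul_nonneg (mul_nonneg hβ (hJ u v)) ?_
  cases b <;> simp only [cond_true, cond_false] <;> linarith

variable [Fintype Λ]

theorem setIntegral_xyBox {f : (Λ → AddCircle (2 * π)) → ℝ} (hf : Continuous f) :
    ∫ φ in xyBox Λ, f (fun z => (φ z : AddCircle (2 * π))) = ∫ g, f g := by
  have hmk : MeasurePreserving (fun (φ : Λ → ℝ) z => (φ z : AddCircle (2 * π)))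
      (volume.restrict (xyBox Λ)) volume := by
    rw [xyBox, volume_pi, Measure.restrict_pi_pi]
    refine measurePreserving_pi _ _ fun _ => ?_
    rw [← Measure.restrict_congr_set Ioc_ae_eq_Icc]
    simpa using AddCircle.measurePreserving_mk (2 * π) 0
  rw [← hmk.map_eq, integral_map hmk.measurable.aemeasurable hf.aestronglyMeasurable]

/-- The Gibbs weight `exp (-β H)` on the torus. -/
noncomputable def torusWeight (J η : Λ → Λ → ℝ) (β : ℝ) (g : Λ → AddCircle (2 * π)) : ℝ :=
  Real.exp (∑ i, pairCoupling J η β i * (pairAngle i g).cos)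

theorem continuous_torusWeight (J η : Λ → Λ → ℝ) (β : ℝ) : Continuous (torusWeight J η β) := by
  have hcos := Real.Angle.continuous_cos
  have hpair := continuous_pairAngle (Λ := Λ)
  unfold torusWeight
  fun_prop

theorem torusWeight_add (J K η : Λ → Λ → ℝ) (β : ℝ) (g : Λ → AddCircle (2 * π)) :
    torusWeight (J + K) η β g = torusWeight K η β g * torusWeight J η β g := by
  rw [torusWeight, torusWeight, torusWeight, ← Real.exp_add, ← Finset.sum_add_distrib]
  refine congrArg _ (Finset.sum_congr rfl fun i _ => ?_)
  simp only [pairCoupling, Pi.add_apply]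
  ring

theorem torusWeight_coe (J η : Λ → Λ → ℝ) (β : ℝ) (φ : Λ → ℝ) :
    torusWeight J η β (fun z => (φ z : AddCircle (2 * π))) =
      Real.exp (-β * xyHam2 J η φ) := by
  have hadd (u v : Λ) : (pairAngle (u, v, true) fun z => (φ z : AddCircle (2 * π))).cos =
      Real.cos (φ u + φ v) := Real.Angle.cos_coe (φ u + φ v)
  have hsub (u v : Λ) : (pairAngle (u, v, false) fun z => (φ z : AddCircle (2 * π))).cos =
      Real.cos (φ u - φ v) := Real.Angle.cos_coe (φ u - φ v)
  rw [torusWeight, xyHam2, neg_mul_neg]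
  congr 1
  simp only [Fintype.sum_prod_type, Fintype.sum_bool, hadd, hsub, pairCoupling, cond_true,
    cond_false, Real.cos_add, Real.cos_sub, Finset.mul_sum]
  exact Finset.sum_congr rfl fun u _ => Finset.sum_congr rfl fun v _ => by ring

theorem xyGibbs2_prod_cos (J η : Λ → Λ → ℝ) (β : ℝ) (A : Finset Λ) :
    xyGibbs2 J η β (fun φ => ∏ z ∈ A, Real.cos (φ z)) =
      (∫ g, (∏ z ∈ A, (torusAngle z g).cos) * torusWeight J η β g) /
        ∫ g, torusWeight J η β g := by
  have hcos := Real.Angle.continuous_cos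
  have hangle := continuous_torusAngle (Λ := Λ)
  have hw := continuous_torusWeight J η β
  rw [← setIntegral_xyBox hw, ← setIntegral_xyBox (by fun_prop)]
  simp only [torusWeight_coe]
  rfl

theorem integral_torusWeight_pos (J η : Λ → Λ → ℝ) (β : ℝ) :
    0 < ∫ g, torusWeight J η β g :=
  integral_exp_pos (continuous_torusWeight J η β).integrable_of_compactSpace

theorem xyGibbs2_prod_cos_mono {J J' η : Λ → Λ → ℝ} (hJ : ∀ u v, 0 ≤ J u v)
    (hη : ∀ u v, |η u v| ≤ 1) (hle : ∀ u v, J u v ≤ J' u v) (A : Finset Λ) {β : ℝ}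
    (hβ : 0 ≤ β) :
    xyGibbs2 J η β (fun φ => ∏ z ∈ A, Real.cos (φ z)) ≤
      xyGibbs2 J' η β (fun φ => ∏ z ∈ A, Real.cos (φ z)) := by
  have hhalf (g : Λ → AddCircle (2 * π)) : ∃ h, h + h = g := by
    choose r hr using fun z => QuotientAddGroup.mk_surjective (g z)
    refine ⟨fun z => ((r z / 2 : ℝ) : AddCircle (2 * π)), funext fun z => ?_⟩
    rw [Pi.add_apply, ← AddCircle.coe_add, add_halves]
    exact hr z
  have hcov := weightedCov_prod_cos_exp_nonneg
    (μ := (volume : Measure (Λ → AddCircle (2 * π)))) hhalf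
    (pairCoupling_nonneg hJ hη hβ) continuous_pairAngle A continuous_torusAngle
    (pairCoupling_nonneg (J := J' - J) (fun u v => sub_nonneg.2 (hle u v)) hη hβ)
    continuous_pairAngle
  have hadd := torusWeight_add J (J' - J) η β
  rw [add_sub_cancel] at hadd
  rw [xyGibbs2_prod_cos, xyGibbs2_prod_cos,
    div_le_div_iff₀ (integral_torusWeight_pos J η β) (integral_torusWeight_pos J' η β)]
  simp only [hadd, ← mul_assoc]
  refine (sub_nonneg.1 hcov).trans_eq (mul_comm _ _)

end Torus

/-- For the two-body classical XY model with `J_{xy} ≥ 0` and `|η_{xy}| ≤ 1`, the correlation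
`⟨∏_{z∈A} cos φ_z⟩` is nondecreasing in each coupling `J_{xy}`. -/
theorem classical_xy_two_body_monotone {Λ : Type*} [Fintype Λ]
    (J J' η : Λ → Λ → ℝ)
    (hJ : ∀ x y : Λ, 0 ≤ J x y) (hJ' : ∀ x y : Λ, 0 ≤ J' x y)
    (hη : ∀ x y : Λ, |η x y| ≤ 1)
    (x y : Λ) (hagree : ∀ u v : Λ, (u, v) ≠ (x, y) → J u v = J' u v)
    (hle : J x y ≤ J' x y)
    (A : Finset Λ) (β : ℝ) (hβ : 0 < β) :
    xyGibbs2 J η β (fun φ => ∏ z ∈ A, Real.cos (φ z)) ≤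
      xyGibbs2 J' η β (fun φ => ∏ z ∈ A, Real.cos (φ z)) := by
  refine xyGibbs2_prod_cos_mono hJ hη (fun u v => ?_) A hβ.le
  by_cases h : (u, v) = (x, y)
  · obtain ⟨rfl, rfl⟩ := Prod.mk.inj h
    exact hle
  · exact (hagree u v h).le
end

section
/- Assume J¹_A ≥ 0 and J²_A ≥ 0 for all A ⊆ Λ. Then for every X ⊆ Λ and every β > 0, the classical XY expectation is dominated by the Ising expectation with couplings {J¹_A}: ⟨∏_{x∈X} σ¹_x⟩_XY ≤ ⟨∏_{x∈X} s_x⟩_Ising, where the Ising model has coupling constants J_A = J¹_A. -/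
open MeasureTheory Real

/-- The ±1 value of an Ising spin encoded by a Boolean. -/
def isingSpin (b : Bool) : ℝ := if b then 1 else -1

/-- Ising Hamiltonian with many-body couplings: `H(s) = −Σ_{A⊆Λ} J_A ∏_{x∈A} s_x`. -/
noncomputable def isingHam {Λ : Type*} [Fintype Λ] (J : Finset Λ → ℝ) (s : Λ → Bool) : ℝ :=
  - ∑ A : Finset Λ, J A * ∏ x ∈ A, isingSpin (s x)

/-- Ising Gibbs expectation at inverse temperature `β`:
`⟨f⟩ = Z⁻¹ Σ_s f(s) e^{−βH(s)}`. -/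
noncomputable def isingGibbs {Λ : Type*} [Fintype Λ] [DecidableEq Λ] (J : Finset Λ → ℝ)
    (β : ℝ) (f : (Λ → Bool) → ℝ) : ℝ :=
  (∑ s : Λ → Bool, f s * Real.exp (-β * isingHam J s)) /
  (∑ s : Λ → Bool, Real.exp (-β * isingHam J s))

/-- `s_B = ∏_{x∈B} s_x`. -/
def isingSigma {Λ : Type*} (B : Finset Λ) (s : Λ → Bool) : ℝ :=
  ∏ x ∈ B, isingSpin (s x)

lemma isingSpin_mul_self (b : Bool) : isingSpin b * isingSpin b = 1 := by
  cases b <;> norm_num [isingSpin]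

lemma isingSpin_beq (a b : Bool) : isingSpin (a == b) = isingSpin a * isingSpin b := by
  cases a <;> cases b <;> norm_num [isingSpin]

lemma isingSigma_beq {Λ : Type*} (A : Finset Λ) (s t : Λ → Bool) :
    isingSigma A (fun x => s x == t x) = isingSigma A s * isingSigma A t := by
  simp only [isingSigma, isingSpin_beq, Finset.prod_mul_distrib]

lemma isingSigma_eq_one_or_neg_one {Λ : Type*} (A : Finset Λ) (s : Λ → Bool) :
    isingSigma A s = 1 ∨ isingSigma A s = -1 := by
  rw [← sq_eq_one_iff, sq, isingSigma, ← Finset.prod_mul_distrib]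
  simp only [isingSpin_mul_self, Finset.prod_const_one]

lemma abs_isingSigma {Λ : Type*} (A : Finset Λ) (s : Λ → Bool) : |isingSigma A s| = 1 := by
  rcases isingSigma_eq_one_or_neg_one A s with h | h <;> simp [h]

lemma isingSigma_mul {Λ : Type*} [DecidableEq Λ] (A B : Finset Λ) (s : Λ → Bool) :
    isingSigma A s * isingSigma B s = isingSigma (symmDiff A B) s := by
  have hA := Finset.prod_inter_mul_prod_sdiff A B (fun x => isingSpin (s x))
  have hB := Finset.prod_inter_mul_prod_sdiff B A (fun x => isingSpin (s x))
  have hd : Disjoint (A \ B) (B \ A) := disjoint_sdiff_sdiff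
  have hAB : symmDiff A B = A \ B ∪ B \ A := rfl
  have h1 : (∏ x ∈ A ∩ B, isingSpin (s x)) * ∏ x ∈ A ∩ B, isingSpin (s x) = 1 := by
    rw [← Finset.prod_mul_distrib]
    simp only [isingSpin_mul_self, Finset.prod_const_one]
  rw [isingSigma, isingSigma, isingSigma, hAB, Finset.prod_union hd, ← hA, ← hB,
    Finset.inter_comm B A]
  linear_combination (∏ x ∈ A \ B, isingSpin (s x)) * (∏ x ∈ B \ A, isingSpin (s x)) * h1

lemma sum_isingSigma_nonneg {Λ : Type*} [Fintype Λ] [DecidableEq Λ] (X : Finset Λ) :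
    0 ≤ ∑ s : Λ → Bool, isingSigma X s := by
  have h : ∀ s : Λ → Bool, isingSigma X s = ∏ x, if x ∈ X then isingSpin (s x) else 1 := by
    intro s
    simp [isingSigma, Finset.prod_ite_mem]
  simp only [h]
  rw [← Fintype.prod_sum fun x b => if x ∈ X then isingSpin b else 1]
  refine Finset.prod_nonneg fun x _ => ?_
  by_cases hx : x ∈ X <;> simp [hx, isingSpin]

/-- Griffiths' first inequality, for a product of Boltzmann factors. -/
lemma sum_isingSigma_mul_prod_exp_nonneg {Λ : Type*} [Fintype Λ] [DecidableEq Λ]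
    {K : Finset Λ → ℝ} (hK : ∀ A, 0 ≤ K A) (S : Finset (Finset Λ)) (X : Finset Λ) :
    0 ≤ ∑ s : Λ → Bool, isingSigma X s * ∏ A ∈ S, exp (K A * isingSigma A s) := by
  induction S using Finset.induction_on generalizing X with
  | empty => simpa using sum_isingSigma_nonneg X
  | insert A S hA ih =>
    have hexp : ∀ s : Λ → Bool,
        exp (K A * isingSigma A s) = cosh (K A) + sinh (K A) * isingSigma A s := by
      intro s
      rcases isingSigma_eq_one_or_neg_one A s with h | h
      · simp [h, cosh_add_sinh]
      · simp [h, ← cosh_sub_sinh, sub_eq_add_neg]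
    have hsum : ∑ s : Λ → Bool, isingSigma X s * ∏ B ∈ insert A S, exp (K B * isingSigma B s) =
        cosh (K A) * ∑ s : Λ → Bool, isingSigma X s * ∏ B ∈ S, exp (K B * isingSigma B s) +
        sinh (K A) * ∑ s : Λ → Bool,
          isingSigma (symmDiff X A) s * ∏ B ∈ S, exp (K B * isingSigma B s) := by
      rw [Finset.mul_sum, Finset.mul_sum, ← Finset.sum_add_distrib]
      refine Finset.sum_congr rfl fun s _ => ?_
      rw [Finset.prod_insert hA, hexp, ← isingSigma_mul]
      ring
    rw [hsum]
    exact add_nonneg (mul_nonneg (cosh_pos _).le (ih X))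
      (mul_nonneg (sinh_nonneg_iff.2 (hK A)) (ih _))

/-- Griffiths' first inequality. -/
lemma sum_isingSigma_mul_exp_nonneg {Λ : Type*} [Fintype Λ] [DecidableEq Λ]
    {K : Finset Λ → ℝ} (hK : ∀ A, 0 ≤ K A) (X : Finset Λ) :
    0 ≤ ∑ s : Λ → Bool, isingSigma X s * exp (∑ A, K A * isingSigma A s) := by
  simpa only [exp_sum] using sum_isingSigma_mul_prod_exp_nonneg hK Finset.univ X

lemma beq_involutive {Λ : Type*} (t : Λ → Bool) :
    Function.Involutive fun s : Λ → Bool => fun x => t x == s x := by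
  intro s
  funext x
  cases h : t x <;> cases h' : s x <;> simp [h, h']

/-- Griffiths' second inequality in its comparison form: correlations increase when couplings
are replaced by larger couplings dominating their absolute values. -/
lemma sum_sum_isingSigma_sub_mul_exp_nonneg {Λ : Type*} [Fintype Λ] [DecidableEq Λ]
    {J K : Finset Λ → ℝ} (hJK : ∀ A, |K A| ≤ J A) {c : ℝ} (hc : |c| ≤ 1) (X : Finset Λ) :
    0 ≤ ∑ s : Λ → Bool, ∑ t : Λ → Bool, (isingSigma X t - c * isingSigma X s) *
      (exp (∑ A, J A * isingSigma A t) * exp (∑ A, K A * isingSigma A s)) := by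
  have hmul : ∀ (a : ℝ) (A : Finset Λ) (u : Λ → Bool), |a * isingSigma A u| = |a| := by
    intro a A u
    rw [abs_mul, abs_isingSigma, mul_one]
  have hsubst : ∀ t : Λ → Bool,
      ∑ s : Λ → Bool, (isingSigma X t - c * isingSigma X s) *
        (exp (∑ A, J A * isingSigma A t) * exp (∑ A, K A * isingSigma A s)) =
      ∑ u : Λ → Bool, (1 - c * isingSigma X u) * (isingSigma X t *
        exp (∑ A, (J A + K A * isingSigma A u) * isingSigma A t)) := by
    intro t
    rw [← Equiv.sum_comp (beq_involutive t).toPerm]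
    refine Finset.sum_congr rfl fun u _ => ?_
    simp only [Function.Involutive.coe_toPerm, isingSigma_beq]
    rw [← exp_add, ← Finset.sum_add_distrib]
    rw [show ∑ A, (J A + K A * isingSigma A u) * isingSigma A t =
      ∑ A, (J A * isingSigma A t + K A * (isingSigma A t * isingSigma A u)) from
        Finset.sum_congr rfl fun A _ => by ring]
    ring
  rw [Finset.sum_comm, Finset.sum_congr rfl fun t _ => hsubst t, Finset.sum_comm]
  refine Finset.sum_nonneg fun u _ => ?_
  rw [← Finset.mul_sum]
  refine mul_nonneg ?_ (sum_isingSigma_mul_exp_nonneg (fun A => ?_) X)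
  · have := (le_abs_self _).trans_eq (hmul c X u)
    linarith
  · have := (neg_abs_le (K A * isingSigma A u))
    rw [hmul] at this
    linarith [hJK A]

/-- The reflection `φ ↦ π - φ` modulo `2π`, as a map of `[0, 2π]` to itself. -/
noncomputable def cosReflect (φ : ℝ) : ℝ := if φ ≤ π then π - φ else 3 * π - φ

lemma cos_cosReflect (φ : ℝ) : cos (cosReflect φ) = -cos φ := by
  unfold cosReflect
  split_ifs
  · exact cos_pi_sub φ
  · rw [show 3 * π - φ = π - φ + 2 * π by ring, cos_add_two_pi, cos_pi_sub]

lemma sin_cosReflect (φ : ℝ) : sin (cosReflect φ) = sin φ := by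
  unfold cosReflect
  split_ifs
  · exact sin_pi_sub φ
  · rw [show 3 * π - φ = π - φ + 2 * π by ring, sin_add_two_pi, sin_pi_sub]

lemma measurable_cosReflect : Measurable cosReflect :=
  Measurable.ite measurableSet_Iic (by fun_prop) (by fun_prop)

lemma measurePreserving_cosReflect :
    MeasurePreserving cosReflect (volume.restrict (Set.Icc 0 (2 * π)))
      (volume.restrict (Set.Icc 0 (2 * π))) := by
  have hpi := pi_pos
  refine ⟨measurable_cosReflect, ?_⟩
  have hunion : Set.Icc 0 (2 * π) = Set.Icc 0 π ∪ Set.Ioc π (2 * π) :=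
    (Set.Icc_union_Ioc_eq_Icc hpi.le (by linarith)).symm
  have hsplit : (volume : Measure ℝ).restrict (Set.Icc 0 (2 * π)) =
      volume.restrict (Set.Icc 0 π) + volume.restrict (Set.Ioc π (2 * π)) := by
    rw [hunion, Measure.restrict_union _ measurableSet_Ioc]
    exact Set.disjoint_left.2 fun x hx hx' => absurd hx'.1 (not_lt.2 hx.2)
  have hleft : (volume.restrict (Set.Icc 0 π)).map cosReflect = volume.restrict (Set.Icc 0 π) := by
    have hmp := (Measure.measurePreserving_sub_left volume π).restrict_preimage
      (measurableSet_Icc (a := (0 : ℝ)) (b := π))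
    have hpre : (fun x => π - x) ⁻¹' Set.Icc 0 π = Set.Icc 0 π := by simp
    rw [hpre] at hmp
    refine (Measure.map_congr ?_).trans hmp.map_eq
    filter_upwards [ae_restrict_mem measurableSet_Icc] with x hx
    exact if_pos hx.2
  have hright : (volume.restrict (Set.Ioc π (2 * π))).map cosReflect =
      volume.restrict (Set.Ioc π (2 * π)) := by
    have hmp := (Measure.measurePreserving_sub_left volume (3 * π)).restrict_preimage
      (measurableSet_Ico (a := π) (b := 2 * π))
    have hpre : (fun x => 3 * π - x) ⁻¹' Set.Ico π (2 * π) = Set.Ioc π (2 * π) := by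
      rw [Set.preimage_const_sub_Ico]
      congr 1 <;> ring
    rw [hpre] at hmp
    rw [← restrict_Ico_eq_restrict_Ioc] at hmp ⊢
    refine (Measure.map_congr ?_).trans hmp.map_eq
    rw [restrict_Ico_eq_restrict_Ioc]
    filter_upwards [ae_restrict_mem measurableSet_Ioc] with x hx
    exact if_neg (not_le.2 hx.1)
  rw [hsplit, Measure.map_add _ _ measurable_cosReflect, hleft, hright]

/-- Reflects the cosines of those angles whose Ising spin is `-1`. -/
noncomputable def xyReflect {Λ : Type*} (s : Λ → Bool) (φ : Λ → ℝ) (x : Λ) : ℝ :=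
  if s x then φ x else cosReflect (φ x)

lemma sigma1_xyReflect {Λ : Type*} (A : Finset Λ) (s : Λ → Bool) (φ : Λ → ℝ) :
    sigma1 A (xyReflect s φ) = sigma1 A φ * isingSigma A s := by
  rw [sigma1, sigma1, isingSigma, ← Finset.prod_mul_distrib]
  refine Finset.prod_congr rfl fun x _ => ?_
  cases h : s x <;> simp [xyReflect, isingSpin, cos_cosReflect, h]

lemma sigma2_xyReflect {Λ : Type*} (A : Finset Λ) (s : Λ → Bool) (φ : Λ → ℝ) :
    sigma2 A (xyReflect s φ) = sigma2 A φ := by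
  refine Finset.prod_congr rfl fun x _ => ?_
  cases h : s x <;> simp [xyReflect, sin_cosReflect, h]

lemma measurePreserving_xyReflect {Λ : Type*} [Fintype Λ] (s : Λ → Bool) :
    MeasurePreserving (xyReflect s) (volume.restrict (xyBox Λ)) (volume.restrict (xyBox Λ)) := by
  have hbox : (volume : Measure (Λ → ℝ)).restrict (xyBox Λ) =
      Measure.pi fun _ => volume.restrict (Set.Icc 0 (2 * π)) :=
    Measure.restrict_pi_pi _ _
  rw [hbox]
  refine measurePreserving_pi (f := fun x θ => if s x then θ else cosReflect θ) _ _ fun x => ?_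
  cases s x
  · simpa using measurePreserving_cosReflect
  · exact MeasurePreserving.id _

lemma abs_sigma1_le_one {Λ : Type*} (A : Finset Λ) (φ : Λ → ℝ) : |sigma1 A φ| ≤ 1 := by
  rw [sigma1, Finset.abs_prod]
  exact Finset.prod_le_one (fun _ _ => abs_nonneg _) fun _ _ => abs_cos_le_one _

lemma continuous_sigma1 {Λ : Type*} (A : Finset Λ) : Continuous (sigma1 A) := by
  unfold sigma1
  fun_prop

lemma continuous_xyHam {Λ : Type*} [Fintype Λ] (J1 J2 : Finset Λ → ℝ) :
    Continuous (xyHam J1 J2) := by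
  unfold xyHam
  fun_prop

lemma neg_mul_isingHam {Λ : Type*} [Fintype Λ] (J : Finset Λ → ℝ) (β : ℝ) (s : Λ → Bool) :
    -β * isingHam J s = ∑ A, β * J A * isingSigma A s := by
  simp [isingHam, isingSigma, Finset.mul_sum, mul_assoc]

lemma neg_mul_xyHam_xyReflect {Λ : Type*} [Fintype Λ] (J1 J2 : Finset Λ → ℝ) (β : ℝ)
    (s : Λ → Bool) (φ : Λ → ℝ) :
    -β * xyHam J1 J2 (xyReflect s φ) =
      ∑ A, β * J1 A * sigma1 A φ * isingSigma A s + β * ∑ A, J2 A * sigma2 A φ := by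
  have h : xyHam J1 J2 (xyReflect s φ) = -∑ A, (J1 A * (sigma1 A φ * isingSigma A s) +
      J2 A * sigma2 A φ) := by
    simp only [← sigma1_xyReflect]
    simp only [← sigma2_xyReflect _ s φ]
    rfl
  rw [h, Finset.sum_add_distrib, neg_mul_neg, mul_add, Finset.mul_sum]
  simp only [mul_assoc]

/-- Comparison between the classical XY and Ising models:
`⟨∏_{x∈X} σ¹_x⟩_XY ≤ ⟨∏_{x∈X} s_x⟩_Ising` with Ising couplings `J_A = J¹_A`. -/
theorem classical_xy_le_ising {Λ : Type*} [Fintype Λ] [DecidableEq Λ]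
    (J1 J2 : Finset Λ → ℝ)
    (hJ1 : ∀ A : Finset Λ, 0 ≤ J1 A) (hJ2 : ∀ A : Finset Λ, 0 ≤ J2 A)
    (X : Finset Λ) (β : ℝ) (hβ : 0 < β) :
    xyGibbs J1 J2 β (sigma1 X) ≤ isingGibbs J1 β (isingSigma X) := by
  have hJ : ∀ A, 0 ≤ β * J1 A := fun A => mul_nonneg hβ.le (hJ1 A)
  unfold xyGibbs isingGibbs
  simp only [neg_mul_isingHam]
  set N := ∑ t : Λ → Bool, isingSigma X t * exp (∑ A, β * J1 A * isingSigma A t) with hN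
  set Z := ∑ t : Λ → Bool, exp (∑ A, β * J1 A * isingSigma A t) with hZ
  have hZpos : 0 < Z := Finset.sum_pos (fun _ _ => exp_pos _) Finset.univ_nonempty
  have hNnonneg : 0 ≤ N := sum_isingSigma_mul_exp_nonneg hJ X
  set G : (Λ → ℝ) → ℝ := fun φ => exp (-β * xyHam J1 J2 φ) with hG
  have hGcont : Continuous G := continuous_exp.comp (continuous_const.mul (continuous_xyHam J1 J2))
  have hcompact : IsCompact (xyBox Λ) := isCompact_univ_pi fun _ => isCompact_Icc
  have hGint : IntegrableOn G (xyBox Λ) := hGcont.continuousOn.integrableOn_compact hcompact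
  have hFint : IntegrableOn (fun φ => sigma1 X φ * G φ) (xyBox Λ) :=
    ((continuous_sigma1 X).mul hGcont).continuousOn.integrableOn_compact hcompact
  set D : (Λ → ℝ) → ℝ := fun φ => N * G φ - Z * (sigma1 X φ * G φ) with hD
  have hDint : IntegrableOn D (xyBox Λ) := (hGint.const_mul N).sub (hFint.const_mul Z)
  have hpointwise : ∀ φ, 0 ≤ ∑ s : Λ → Bool, D (xyReflect s φ) := by
    intro φ
    have hsum : ∑ s : Λ → Bool, D (xyReflect s φ) =
        exp (β * ∑ A, J2 A * sigma2 A φ) * ∑ s : Λ → Bool, ∑ t : Λ → Bool,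
          (isingSigma X t - sigma1 X φ * isingSigma X s) *
            (exp (∑ A, β * J1 A * isingSigma A t) *
              exp (∑ A, β * J1 A * sigma1 A φ * isingSigma A s)) := by
      generalize hE : ∑ A, J2 A * sigma2 A φ = E
      rw [Finset.mul_sum]
      refine Finset.sum_congr rfl fun s _ => ?_
      simp only [hD, hG, neg_mul_xyHam_xyReflect, hE, sigma1_xyReflect, hN, hZ, exp_add]
      rw [Finset.sum_mul, Finset.sum_mul, ← Finset.sum_sub_distrib, Finset.mul_sum]
      exact Finset.sum_congr rfl fun t _ => by ring
    rw [hsum]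
    refine mul_nonneg (exp_pos _).le
      (sum_sum_isingSigma_sub_mul_exp_nonneg (fun A => ?_) (abs_sigma1_le_one X φ) X)
    rw [abs_mul, abs_of_nonneg (hJ A)]
    exact mul_le_of_le_one_right (hJ A) (abs_sigma1_le_one A φ)
  have hreflect : ∀ s : Λ → Bool,
      ∫ φ in xyBox Λ, D (xyReflect s φ) = ∫ φ in xyBox Λ, D φ := by
    intro s
    have hmp := measurePreserving_xyReflect s
    have hmeas : AEStronglyMeasurable D
        ((volume.restrict (xyBox Λ)).map (xyReflect s)) := by
      rw [hmp.map_eq]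
      exact hDint.aestronglyMeasurable
    rw [← integral_map hmp.measurable.aemeasurable hmeas, hmp.map_eq]
  have hDnonneg : 0 ≤ ∫ φ in xyBox Λ, D φ := by
    have havg : (Fintype.card (Λ → Bool) : ℝ) * ∫ φ in xyBox Λ, D φ =
        ∫ φ in xyBox Λ, ∑ s : Λ → Bool, D (xyReflect s φ) := by
      have hint : ∀ s ∈ Finset.univ, IntegrableOn (fun φ => D (xyReflect s φ)) (xyBox Λ) :=
        fun s _ => (measurePreserving_xyReflect s).integrable_comp_of_integrable hDint
      rw [integral_finsetSum _ hint]
      simp only [hreflect, Finset.sum_const, Finset.card_univ, nsmul_eq_mul]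
    refine nonneg_of_mul_nonneg_right (havg ▸ integral_nonneg hpointwise) ?_
    exact Nat.cast_pos.2 Fintype.card_pos
  rw [hD, integral_sub (hGint.const_mul N) (hFint.const_mul Z), integral_const_mul,
    integral_const_mul] at hDnonneg
  refine div_le_of_le_mul₀ (integral_nonneg fun _ => (exp_pos _).le)
    (div_nonneg hNnonneg hZpos.le) ?_
  rw [div_mul_eq_mul_div, le_div_iff₀ hZpos]
  linarith
end

section
/- (FKG inequality.) Let N ∈ ℕ, let μ be a probability measure on [0,π/2], and let p : [0,π/2]^N → ℝ be a bounded measurable nonnegative function with ∫ p(ψ) ∏_i dμ(ψ_i) = 1 and satisfying p(ψ∨ξ) p(ψ∧ξ) ≥ p(ψ) p(ξ) for all ψ, ξ ∈ [0,π/2]^N, where (ψ∨ξ)_i = max(ψ_i,ξ_i) and (ψ∧ξ)_i = min(ψ_i,ξ_i). Let dν(ψ) = p(ψ) ∏_{i=1}^N dμ(ψ_i). If f and g are bounded measurable functions on [0,π/2]^N that are both nondecreasing (or both nonincreasing) with respect to the coordinatewise partial order, then ∫ f g dν ≥ (∫ f dν)(∫ g dν); if one is nondecreasing and the other nonincreasing,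 then ∫ f g dν ≤ (∫ f dν)(∫ g dν). -/
open MeasureTheory Real

open scoped ENNReal

/-- If `a, b ≤ c` and `a * b ≤ c * d`, then `a + b ≤ c + d`. -/
theorem ENNReal.add_le_add_of_mul_le_mul {a b c d : ℝ≥0∞} (hac : a ≤ c) (hbc : b ≤ c)
    (h : a * b ≤ c * d) : a + b ≤ c + d := by
  rcases eq_or_ne c ⊤ with rfl | hc
  · simp
  rcases eq_or_ne d ⊤ with rfl | hd
  · simp
  lift a to NNReal using ne_top_of_le_ne_top hc hac
  lift b to NNReal using ne_top_of_le_ne_top hc hbc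
  lift c to NNReal using hc
  lift d to NNReal using hd
  norm_cast at *
  rw [← NNReal.coe_le_coe] at *
  push_cast at *
  rcases (NNReal.coe_nonneg c).eq_or_lt with h0 | h0
  · linarith [NNReal.coe_nonneg d]
  · refine le_of_mul_le_mul_left ?_ h0
    nlinarith [mul_nonneg (sub_nonneg.2 hac) (sub_nonneg.2 hbc)]

/-- Integrating out the first coordinate last. -/
theorem lintegral_pi_fin_succ {α : Type*} [MeasurableSpace α] (μ : Measure α)
    [SigmaFinite μ] {n : ℕ}
    {f : (Fin (n + 1) → α) → ℝ≥0∞} (hf : Measurable f) :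
    ∫⁻ x, f x ∂(Measure.pi fun _ => μ) =
      ∫⁻ t, ∫⁻ x, f (Fin.cons t x) ∂(Measure.pi fun _ => μ) ∂μ := by
  have e := (measurePreserving_piFinSuccAbove (fun _ : Fin (n + 1) => μ) 0).symm
  rw [← e.lintegral_comp hf,
    lintegral_prod (fun z => f ((MeasurableEquiv.piFinSuccAbove (fun _ => α) 0).symm z))
      (hf.comp e.measurable).aemeasurable]
  simp [MeasurableEquiv.piFinSuccAbove, Fin.insertNthEquiv]

theorem measurable_fin_cons {α : Type*} [MeasurableSpace α] {n : ℕ} :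
    Measurable fun z : α × (Fin n → α) => (Fin.cons z.1 z.2 : Fin (n + 1) → α) := by
  refine measurable_pi_lambda _ fun i => ?_
  refine Fin.cases ?_ (fun i => ?_) i
  · simpa using measurable_fst
  · simp only [Fin.cons_succ]
    exact (measurable_pi_apply i).comp measurable_snd

section FourFunctions

variable {α : Type*} [LinearOrder α] [MeasurableSpace α]

/-- The four functions theorem for integrals over a linear order. -/
theorem lintegral_mul_lintegral_le_of_linearOrder (μ : Measure α) [SFinite μ]
    {f₁ f₂ f₃ f₄ : α → ℝ≥0∞} (h₁ : Measurable f₁) (h₂ : Measurable f₂) (h₃ : Measurable f₃)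
    (h₄ : Measurable f₄) (h : ∀ x y, f₁ x * f₂ y ≤ f₃ (x ⊔ y) * f₄ (x ⊓ y)) :
    (∫⁻ x, f₁ x ∂μ) * ∫⁻ x, f₂ x ∂μ ≤ (∫⁻ x, f₃ x ∂μ) * ∫⁻ x, f₄ x ∂μ := by
  have symmetrize : ∀ {u v : α → ℝ≥0∞}, Measurable u → Measurable v →
      ∫⁻ z, (u z.1 * v z.2 + u z.2 * v z.1) ∂(μ.prod μ) =
        2 * ((∫⁻ x, u x ∂μ) * ∫⁻ x, v x ∂μ) := by
    intro u v hu hv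
    rw [lintegral_add_left (by fun_prop), lintegral_prod_mul hu.aemeasurable hv.aemeasurable]
    simp_rw [mul_comm (u _) (v _)]
    rw [lintegral_prod_mul hv.aemeasurable hu.aemeasurable, mul_comm (∫⁻ x, v x ∂μ), two_mul]
  have key : ∀ x y, x ≤ y →
      f₁ x * f₂ y + f₁ y * f₂ x ≤ f₃ x * f₄ y + f₃ y * f₄ x := by
    intro x y hxy
    rw [add_comm (f₃ x * f₄ y)]
    refine ENNReal.add_le_add_of_mul_le_mul ?_ ?_ ?_
    · simpa [hxy] using h x y
    · simpa [hxy] using h y x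
    · calc f₁ x * f₂ y * (f₁ y * f₂ x) = f₁ x * f₂ x * (f₁ y * f₂ y) := by ring
        _ ≤ f₃ x * f₄ x * (f₃ y * f₄ y) := by
          exact mul_le_mul' (by simpa using h x x) (by simpa using h y y)
        _ = f₃ y * f₄ x * (f₃ x * f₄ y) := by ring
  rw [← ENNReal.mul_le_mul_iff_right two_ne_zero ENNReal.ofNat_ne_top, ← symmetrize h₁ h₂,
    ← symmetrize h₃ h₄]
  refine lintegral_mono fun z => ?_
  rcases le_total z.1 z.2 with hz | hz
  · exact key _ _ hz
  · rw [add_comm, add_comm (f₃ z.1 * _)]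
    exact key _ _ hz

/-- The four functions theorem for integrals against a product measure on a finite power of a
linear order. -/
theorem lintegral_pi_mul_lintegral_pi_le (μ : Measure α) [SigmaFinite μ] :
    ∀ {n : ℕ} {f₁ f₂ f₃ f₄ : (Fin n → α) → ℝ≥0∞}, Measurable f₁ → Measurable f₂ →
      Measurable f₃ → Measurable f₄ → (∀ x y, f₁ x * f₂ y ≤ f₃ (x ⊔ y) * f₄ (x ⊓ y)) →
      (∫⁻ x, f₁ x ∂(Measure.pi fun _ => μ)) * ∫⁻ x, f₂ x ∂(Measure.pi fun _ => μ) ≤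
        (∫⁻ x, f₃ x ∂(Measure.pi fun _ => μ)) * ∫⁻ x, f₄ x ∂(Measure.pi fun _ => μ) := by
  intro n
  induction n with
  | zero =>
    intro f₁ f₂ f₃ f₄ _ _ _ _ h
    rw [Measure.pi_of_empty (fun _ : Fin 0 => μ) isEmptyElim]
    simpa using h isEmptyElim isEmptyElim
  | succ n ih =>
    intro f₁ f₂ f₃ f₄ h₁ h₂ h₃ h₄ h
    have hm : ∀ {f : (Fin (n + 1) → α) → ℝ≥0∞}, Measurable f →
        Measurable fun t => ∫⁻ x, f (Fin.cons t x) ∂(Measure.pi fun _ => μ) := fun hf =>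
      Measurable.lintegral_prod_right' (hf.comp measurable_fin_cons)
    have hs : ∀ {f : (Fin (n + 1) → α) → ℝ≥0∞}, Measurable f → ∀ t,
        Measurable fun x => f (Fin.cons t x) := fun hf t =>
      (hf.comp measurable_fin_cons).comp measurable_prodMk_left
    rw [lintegral_pi_fin_succ μ h₁, lintegral_pi_fin_succ μ h₂, lintegral_pi_fin_succ μ h₃,
      lintegral_pi_fin_succ μ h₄]
    refine lintegral_mul_lintegral_le_of_linearOrder μ (hm h₁) (hm h₂) (hm h₃) (hm h₄)
      fun s t => ih (hs h₁ s) (hs h₂ t) (hs h₃ _) (hs h₄ _) fun x y => ?_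
    convert h (Fin.cons s x) (Fin.cons t y) using 3 <;>
      exact funext fun i => Fin.cases rfl (fun _ => rfl) i

variable {n : ℕ} {p f g : (Fin n → α) → ℝ}

/-- The FKG inequality for nonnegative monotone functions. -/
theorem integral_mul_integral_le_of_monotone_of_nonneg (μ : Measure α) [SigmaFinite μ]
    (hp_meas : Measurable p) (hp_nonneg : ∀ x, 0 ≤ p x)
    (hp_int : Integrable p (Measure.pi fun _ => μ))
    (hp_fkg : ∀ x y, p x * p y ≤ p (x ⊔ y) * p (x ⊓ y))
    (hf_meas : Measurable f) (hg_meas : Measurable g)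
    (hf : Monotone f) (hg : Monotone g) (hf_nonneg : ∀ x, 0 ≤ f x) (hg_nonneg : ∀ x, 0 ≤ g x)
    (hfp : Integrable (fun x => f x * p x) (Measure.pi fun _ => μ))
    (hgp : Integrable (fun x => g x * p x) (Measure.pi fun _ => μ))
    (hfgp : Integrable (fun x => f x * g x * p x) (Measure.pi fun _ => μ)) :
    (∫ x, f x * p x ∂(Measure.pi fun _ => μ)) * ∫ x, g x * p x ∂(Measure.pi fun _ => μ) ≤
      (∫ x, f x * g x * p x ∂(Measure.pi fun _ => μ)) * ∫ x, p x ∂(Measure.pi fun _ => μ) := by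
  have nf : ∀ x, 0 ≤ f x * p x := fun x => mul_nonneg (hf_nonneg x) (hp_nonneg x)
  have ng : ∀ x, 0 ≤ g x * p x := fun x => mul_nonneg (hg_nonneg x) (hp_nonneg x)
  have nfg : ∀ x, 0 ≤ f x * g x * p x := fun x =>
    mul_nonneg (mul_nonneg (hf_nonneg x) (hg_nonneg x)) (hp_nonneg x)
  rw [← ENNReal.ofReal_le_ofReal_iff
      (mul_nonneg (integral_nonneg nfg) (integral_nonneg hp_nonneg)),
    ENNReal.ofReal_mul (integral_nonneg nf), ENNReal.ofReal_mul (integral_nonneg nfg),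
    ofReal_integral_eq_lintegral_ofReal hfp (.of_forall nf),
    ofReal_integral_eq_lintegral_ofReal hgp (.of_forall ng),
    ofReal_integral_eq_lintegral_ofReal hfgp (.of_forall nfg),
    ofReal_integral_eq_lintegral_ofReal hp_int (.of_forall hp_nonneg)]
  refine lintegral_pi_mul_lintegral_pi_le μ (by fun_prop) (by fun_prop) (by fun_prop)
    (by fun_prop) fun x y => ?_
  rw [← ENNReal.ofReal_mul (nf x), ← ENNReal.ofReal_mul (nfg _)]
  refine ENNReal.ofReal_le_ofReal ?_
  calc f x * p x * (g y * p y) = f x * g y * (p x * p y) := by ring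
    _ ≤ f (x ⊔ y) * g (x ⊔ y) * (p (x ⊔ y) * p (x ⊓ y)) :=
      mul_le_mul
        (mul_le_mul (hf le_sup_left) (hg le_sup_right) (hg_nonneg _) (hf_nonneg _))
        (hp_fkg x y) (mul_nonneg (hp_nonneg _) (hp_nonneg _))
        (mul_nonneg (hf_nonneg _) (hg_nonneg _))
    _ = f (x ⊔ y) * g (x ⊔ y) * p (x ⊔ y) * p (x ⊓ y) := by ring

/-- The FKG inequality for bounded monotone functions and a log-supermodular probability
density. -/
theorem integral_mul_integral_le_of_monotone (μ : Measure α) [SigmaFinite μ]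
    (hp_meas : Measurable p) (hp_nonneg : ∀ x, 0 ≤ p x)
    (hp_norm : ∫ x, p x ∂(Measure.pi fun _ => μ) = 1)
    (hp_fkg : ∀ x y, p x * p y ≤ p (x ⊔ y) * p (x ⊓ y))
    (hf_meas : Measurable f) (hf_bdd : ∃ C : ℝ, ∀ x, |f x| ≤ C)
    (hg_meas : Measurable g) (hg_bdd : ∃ C : ℝ, ∀ x, |g x| ≤ C)
    (hf : Monotone f) (hg : Monotone g) :
    (∫ x, f x * p x ∂(Measure.pi fun _ => μ)) * ∫ x, g x * p x ∂(Measure.pi fun _ => μ) ≤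
      ∫ x, f x * g x * p x ∂(Measure.pi fun _ => μ) := by
  obtain ⟨A, hA⟩ := hf_bdd
  obtain ⟨B, hB⟩ := hg_bdd
  have hp_int : Integrable p (Measure.pi fun _ => μ) :=
    .of_integral_ne_zero (by rw [hp_norm]; exact one_ne_zero)
  have hfp : Integrable (fun x => f x * p x) (Measure.pi fun _ => μ) :=
    hp_int.bdd_mul hf_meas.aestronglyMeasurable (.of_forall hA)
  have hgp : Integrable (fun x => g x * p x) (Measure.pi fun _ => μ) :=
    hp_int.bdd_mul hg_meas.aestronglyMeasurable (.of_forall hB)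
  have hfgp : Integrable (fun x => f x * g x * p x) (Measure.pi fun _ => μ) := by
    simpa only [mul_assoc] using hgp.bdd_mul hf_meas.aestronglyMeasurable (.of_forall hA)
  have hfp' : ∀ x, (f x + A) * p x = f x * p x + A * p x := fun x => by ring
  have hgp' : ∀ x, (g x + B) * p x = g x * p x + B * p x := fun x => by ring
  have hfgp' : ∀ x, (f x + A) * (g x + B) * p x =
      f x * g x * p x + B * (f x * p x) + A * (g x * p x) + A * B * p x := fun x => by ring
  have ifp := hfp.add (hp_int.const_mul A)
  have igp := hgp.add (hp_int.const_mul B)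
  have i₁ : Integrable (fun x => f x * g x * p x + B * (f x * p x)) (Measure.pi fun _ => μ) :=
    hfgp.add (hfp.const_mul B)
  have i₂ : Integrable (fun x => f x * g x * p x + B * (f x * p x) + A * (g x * p x))
      (Measure.pi fun _ => μ) := i₁.add (hgp.const_mul A)
  have ifgp := i₂.add (hp_int.const_mul (A * B))
  have key := integral_mul_integral_le_of_monotone_of_nonneg (f := fun x => f x + A)
    (g := fun x => g x + B) μ hp_meas hp_nonneg hp_int hp_fkg (hf_meas.add_const A)
    (hg_meas.add_const B) (hf.add_const A) (hg.add_const B)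
    (fun x => by linarith [neg_le_of_abs_le (hA x)])
    (fun x => by linarith [neg_le_of_abs_le (hB x)])
    (ifp.congr (.of_forall fun x => (hfp' x).symm))
    (igp.congr (.of_forall fun x => (hgp' x).symm))
    (ifgp.congr (.of_forall fun x => (hfgp' x).symm))
  simp only [hfp', hgp', hfgp'] at key
  rw [integral_add hfp (hp_int.const_mul A), integral_add hgp (hp_int.const_mul B),
    integral_add i₂ (hp_int.const_mul (A * B)), integral_add i₁ (hgp.const_mul A),
    integral_add hfgp (hfp.const_mul B)] at key
  simp only [integral_const_mul, hp_norm] at key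
  linarith

end FourFunctions

/-- The FKG inequality on `[0,π/2]^N` for a normalised measure with a log-supermodular
density `p` with respect to a product probability measure: monotone functions of the same
sense are positively correlated, and of opposite senses negatively correlated. -/
theorem fkg_inequality (N : ℕ) (μ : Measure (Set.Icc (0 : ℝ) (π / 2)))
    [IsProbabilityMeasure μ]
    (p : (Fin N → Set.Icc (0 : ℝ) (π / 2)) → ℝ)
    (hp_meas : Measurable p) (hp_bdd : ∃ C : ℝ, ∀ ψ, |p ψ| ≤ C)
    (hp_nonneg : ∀ ψ, 0 ≤ p ψ)
    (hp_norm : ∫ ψ, p ψ ∂(Measure.pi fun _ : Fin N => μ) = 1)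
    (hp_fkg : ∀ ψ ξ, p ψ * p ξ ≤ p (ψ ⊔ ξ) * p (ψ ⊓ ξ))
    (f g : (Fin N → Set.Icc (0 : ℝ) (π / 2)) → ℝ)
    (hf_meas : Measurable f) (hf_bdd : ∃ C : ℝ, ∀ ψ, |f ψ| ≤ C)
    (hg_meas : Measurable g) (hg_bdd : ∃ C : ℝ, ∀ ψ, |g ψ| ≤ C) :
    ((Monotone f ∧ Monotone g) ∨ (Antitone f ∧ Antitone g) →
      (∫ ψ, f ψ * p ψ ∂(Measure.pi fun _ : Fin N => μ)) *
        (∫ ψ, g ψ * p ψ ∂(Measure.pi fun _ : Fin N => μ)) ≤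
      ∫ ψ, f ψ * g ψ * p ψ ∂(Measure.pi fun _ : Fin N => μ)) ∧
    ((Monotone f ∧ Antitone g) ∨ (Antitone f ∧ Monotone g) →
      ∫ ψ, f ψ * g ψ * p ψ ∂(Measure.pi fun _ : Fin N => μ) ≤
      (∫ ψ, f ψ * p ψ ∂(Measure.pi fun _ : Fin N => μ)) *
        (∫ ψ, g ψ * p ψ ∂(Measure.pi fun _ : Fin N => μ))) := by
  have hf_neg : ∃ C : ℝ, ∀ ψ, |(-f) ψ| ≤ C := by simpa using hf_bdd
  have hg_neg : ∃ C : ℝ, ∀ ψ, |(-g) ψ| ≤ C := by simpa using hg_bdd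
  refine ⟨?_, ?_⟩
  · rintro (⟨hf, hg⟩ | ⟨hf, hg⟩)
    · exact integral_mul_integral_le_of_monotone μ hp_meas hp_nonneg hp_norm hp_fkg
        hf_meas hf_bdd hg_meas hg_bdd hf hg
    · simpa [integral_neg] using integral_mul_integral_le_of_monotone μ hp_meas hp_nonneg
        hp_norm hp_fkg hf_meas.neg hf_neg hg_meas.neg hg_neg hf.neg hg.neg
  · rintro (⟨hf, hg⟩ | ⟨hf, hg⟩)
    · simpa [integral_neg] using integral_mul_integral_le_of_monotone μ hp_meas hp_nonneg
        hp_norm hp_fkg hf_meas hf_bdd hg_meas.neg hg_neg hf hg.neg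
    · simpa [integral_neg] using integral_mul_integral_le_of_monotone μ hp_meas hp_nonneg
        hp_norm hp_fkg hf_meas.neg hf_neg hg_meas hg_bdd hf.neg hg
end

section
/- Let Λ be a finite set and let H(φ) = −Σ_{A⊆Λ} (J¹_A ∏_{x∈A} cos φ_x + J²_A ∏_{x∈A} sin φ_x) be the classical XY Hamiltonian. If J¹_A ≥ |J²_A| for all A ⊆ Λ and J²_A = 0 whenever |A| is odd, then there exists a finitely supported family of nonnegative constants K_M ≥ 0, indexed by integer vectors M = (m_x)_{x∈Λ} ∈ ℤ^Λ, such that for every φ ∈ [0,2π]^Λ, H(φ) = −Σ_{M∈ℤ^Λ} K_M cos(Σ_{x∈Λ} m_x φ_x). -/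
open Real
open scoped NNReal

/-- The cone of finite nonnegative combinations of the functions `φ ↦ cos (M·φ)`, `M ∈ ℤ^Λ`. -/
noncomputable def cosCone (Λ : Type*) [Fintype Λ] : Submodule ℝ≥0 ((Λ → ℝ) → ℝ) :=
  Submodule.span ℝ≥0
    (Set.range fun (M : Λ → ℤ) (φ : Λ → ℝ) => Real.cos (∑ x : Λ, (M x : ℝ) * φ x))

section cosCone

variable {Λ : Type*} [Fintype Λ]

theorem cos_sum_mem_cosCone (M : Λ → ℤ) :
    (fun φ : Λ → ℝ => Real.cos (∑ x : Λ, (M x : ℝ) * φ x)) ∈ cosCone Λ :=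
  Submodule.subset_span ⟨M, rfl⟩

theorem one_mem_cosCone : (1 : (Λ → ℝ) → ℝ) ∈ cosCone Λ := by
  convert cos_sum_mem_cosCone (0 : Λ → ℤ) using 1
  funext φ
  simp

theorem smul_mem_cosCone {f : (Λ → ℝ) → ℝ} (hf : f ∈ cosCone Λ) {c : ℝ} (hc : 0 ≤ c) :
    c • f ∈ cosCone Λ :=
  (cosCone Λ).smul_mem ⟨c, hc⟩ hf

theorem mul_mem_cosCone {f g : (Λ → ℝ) → ℝ} (hf : f ∈ cosCone Λ) (hg : g ∈ cosCone Λ) :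
    f * g ∈ cosCone Λ := by
  have h := Submodule.mul_mem_mul hf hg
  rw [cosCone, Submodule.span_mul_span] at h
  refine Submodule.span_le.2 ?_ h
  rintro _ ⟨_, ⟨M, rfl⟩, _, ⟨N, rfl⟩, rfl⟩
  have key := smul_mem_cosCone ((cosCone Λ).add_mem (cos_sum_mem_cosCone (M - N))
    (cos_sum_mem_cosCone (M + N))) (c := 1 / 2) (by norm_num)
  rw [SetLike.mem_coe]
  convert key using 1
  funext φ
  simp only [Pi.mul_apply, Pi.smul_apply, Pi.add_apply, Pi.sub_apply, smul_eq_mul, Int.cast_add,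
    Int.cast_sub, add_mul, sub_mul, Finset.sum_add_distrib, Finset.sum_sub_distrib, Real.cos_add,
    Real.cos_sub]
  ring

theorem cos_apply_mem_cosCone (x : Λ) : (fun φ : Λ → ℝ => Real.cos (φ x)) ∈ cosCone Λ := by
  classical
  convert cos_sum_mem_cosCone (Pi.single x 1 : Λ → ℤ) using 1
  funext φ
  simp [Pi.single_apply]

theorem cos_add_apply_mem_cosCone {x y : Λ} :
    (fun φ : Λ → ℝ => Real.cos (φ x + φ y)) ∈ cosCone Λ := by
  classical
  convert cos_sum_mem_cosCone (Pi.single x 1 + Pi.single y 1 : Λ → ℤ) using 1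
  funext φ
  simp [Pi.single_apply, add_mul, Finset.sum_add_distrib]

theorem cos_sub_apply_mem_cosCone {x y : Λ} :
    (fun φ : Λ → ℝ => Real.cos (φ x - φ y)) ∈ cosCone Λ := by
  classical
  convert cos_sum_mem_cosCone (Pi.single x 1 - Pi.single y 1 : Λ → ℤ) using 1
  funext φ
  simp [Pi.single_apply, sub_mul, Finset.sum_sub_distrib]

theorem prod_cos_mem_cosCone (A : Finset Λ) :
    (fun φ : Λ → ℝ => ∏ x ∈ A, Real.cos (φ x)) ∈ cosCone Λ := by
  classical
  induction A using Finset.induction_on with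
  | empty => exact one_mem_cosCone
  | insert x A hx ih =>
    convert mul_mem_cosCone (cos_apply_mem_cosCone x) ih using 1
    funext φ
    simp [hx]

theorem prod_cos_add_sub_prod_sin_mem_cosCone (n : ℕ) (A : Finset Λ) (hA : A.card = 2 * n) :
    (fun φ : Λ → ℝ => ∏ x ∈ A, Real.cos (φ x) + ∏ x ∈ A, Real.sin (φ x)) ∈ cosCone Λ ∧
    (fun φ : Λ → ℝ => ∏ x ∈ A, Real.cos (φ x) - ∏ x ∈ A, Real.sin (φ x)) ∈ cosCone Λ := by
  classical
  induction n generalizing A with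
  | zero =>
    obtain rfl : A = ∅ := by simpa using hA
    constructor
    · exact (cosCone Λ).add_mem one_mem_cosCone one_mem_cosCone
    · convert (cosCone Λ).zero_mem using 1
      funext φ
      simp
  | succ n ih =>
    obtain ⟨x, C, hx, rfl, hC⟩ :=
      Finset.card_eq_succ.1 (show A.card = (2 * n + 1) + 1 by omega)
    obtain ⟨y, B, hy, rfl, hB⟩ := Finset.card_eq_succ.1 hC
    obtain ⟨hp, hm⟩ := ih B hB
    have hs := cos_sub_apply_mem_cosCone (x := x) (y := y)
    have ha := cos_add_apply_mem_cosCone (x := x) (y := y)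
    constructor
    · convert smul_mem_cosCone ((cosCone Λ).add_mem (mul_mem_cosCone hs hp)
        (mul_mem_cosCone ha hm)) (c := 1 / 2) (by norm_num) using 1
      funext φ
      simp only [Finset.prod_insert hx, Finset.prod_insert hy, Pi.smul_apply, Pi.add_apply,
        Pi.mul_apply, smul_eq_mul, Real.cos_add, Real.cos_sub]
      ring
    · convert smul_mem_cosCone ((cosCone Λ).add_mem (mul_mem_cosCone hs hm)
        (mul_mem_cosCone ha hp)) (c := 1 / 2) (by norm_num) using 1
      funext φ
      simp only [Finset.prod_insert hx, Finset.prod_insert hy, Pi.smul_apply, Pi.add_apply,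
        Pi.mul_apply, smul_eq_mul, Real.cos_add, Real.cos_sub]
      ring

theorem mul_prod_cos_add_mul_prod_sin_mem_cosCone (A : Finset Λ) {c d : ℝ} (h : |d| ≤ c)
    (hodd : Odd A.card → d = 0) :
    (fun φ : Λ → ℝ => c * ∏ x ∈ A, Real.cos (φ x) + d * ∏ x ∈ A, Real.sin (φ x)) ∈
      cosCone Λ := by
  obtain ⟨hl, hr⟩ := abs_le.1 h
  rcases Nat.even_or_odd A.card with hA | hA
  · obtain ⟨n, hn⟩ := hA.exists_two_nsmul
    obtain ⟨hp, hm⟩ := prod_cos_add_sub_prod_sin_mem_cosCone n A (by simpa using hn)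
    convert (cosCone Λ).add_mem (smul_mem_cosCone hp (c := (c + d) / 2) (by linarith))
      (smul_mem_cosCone hm (c := (c - d) / 2) (by linarith)) using 1
    funext φ
    simp only [Pi.smul_apply, Pi.add_apply, smul_eq_mul]
    ring
  · convert smul_mem_cosCone (prod_cos_mem_cosCone A) ((abs_nonneg d).trans h) using 1
    funext φ
    simp [hodd hA]

theorem neg_xyHam_mem_cosCone (J1 J2 : Finset Λ → ℝ) (hJ : ∀ A : Finset Λ, |J2 A| ≤ J1 A)
    (hodd : ∀ A : Finset Λ, Odd A.card → J2 A = 0) :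
    (fun φ => -xyHam J1 J2 φ) ∈ cosCone Λ := by
  convert (cosCone Λ).sum_mem (t := Finset.univ) fun A _ =>
    mul_prod_cos_add_mul_prod_sin_mem_cosCone A (hJ A) (hodd A) using 1
  funext φ
  simp [xyHam]

end cosCone

/-- If `J¹_A ≥ |J²_A|` for all `A` and `J²_A = 0` whenever `|A|` is odd, then the classical XY
Hamiltonian can be rewritten as `H(φ) = −Σ_{M∈ℤ^Λ} K_M cos(M·φ)` with finitely supported
nonnegative coefficients `K_M`. -/
theorem xyHam_eq_cos_series {Λ : Type*} [Fintype Λ] (J1 J2 : Finset Λ → ℝ)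
    (hJ : ∀ A : Finset Λ, |J2 A| ≤ J1 A)
    (hodd : ∀ A : Finset Λ, Odd A.card → J2 A = 0) :
    ∃ K : (Λ → ℤ) → ℝ, (Function.support K).Finite ∧ (∀ M : Λ → ℤ, 0 ≤ K M) ∧
      ∀ φ : Λ → ℝ, (∀ x : Λ, φ x ∈ Set.Icc (0 : ℝ) (2 * π)) →
        xyHam J1 J2 φ = -∑ᶠ M : Λ → ℤ, K M * Real.cos (∑ x : Λ, (M x : ℝ) * φ x) := by
  obtain ⟨K, hK⟩ := Finsupp.mem_span_range_iff_exists_finsupp.1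
    (neg_xyHam_mem_cosCone J1 J2 hJ hodd)
  refine ⟨fun M => K M, K.hasFiniteSupport.subset fun M hM => ?_, fun M => (K M).2,
    fun φ _ => ?_⟩
  · simpa using hM
  · have h := congrFun hK φ
    rw [eq_neg_iff_add_eq_zero, add_comm, ← eq_neg_iff_add_eq_zero, ← h, Finsupp.sum,
      Finset.sum_apply, finsum_eq_sum_of_support_subset]
    · rfl
    · intro M hM
      simp only [Function.mem_support] at hM
      simpa using left_ne_zero_of_mul hM
end

section
/- Let Λ be a finite set, n ∈ ℕ, M_1, …, M_n ∈ ℤ^Λ, and ε_1, …, ε_n ∈ {+1, −1}. Then ∫_{[0,2π]^Λ} ∫_{[0,2π]^Λ} ∏_{s=1}^n ( cos(M_s·φ) + ε_s cos(M_s·φ̄) ) ∏_{x∈Λ} (dφ_x/(2π)) ∏_{x∈Λ} (dφ̄_x/(2π)) ≥ 0. -/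
open MeasureTheory Real

/-- `M·φ = Σ_{x∈Λ} m_x φ_x` for `M ∈ ℤ^Λ` and `φ ∈ [0,2π]^Λ`. -/
noncomputable def zdot {Λ : Type*} [Fintype Λ] (M : Λ → ℤ) (φ : Λ → ℝ) : ℝ :=
  ∑ x : Λ, (M x : ℝ) * φ x

/-- The identification of `AddCircle (2 * π)` with `Real.Angle`. -/
noncomputable def circleToAngle : AddCircle (2 * π) →+ Angle :=
  AddMonoidHom.id (AddCircle (2 * π))

theorem continuous_circleToAngle : Continuous circleToAngle :=
  continuous_id (X := AddCircle (2 * π))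

/-- The analogue `Σ_{x∈Λ} m_x θ_x` of `zdot` on the torus `(ℝ/2πℤ)^Λ`. -/
noncomputable def torusDot {Λ : Type*} [Fintype Λ] (m : Λ → ℤ) : (Λ → AddCircle (2 * π)) →+ Angle where
  toFun θ := ∑ x, m x • circleToAngle (θ x)
  map_zero' := by simp
  map_add' := by simp [smul_add, Finset.sum_add_distrib]

theorem continuous_torusDot {Λ : Type*} [Fintype Λ] (m : Λ → ℤ) : Continuous (torusDot m) :=
  continuous_finsetSum _ fun x _ =>
    (continuous_circleToAngle.comp (continuous_apply x)).zsmul (m x)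

theorem torusDot_coe {Λ : Type*} [Fintype Λ] (m : Λ → ℤ) (φ : Λ → ℝ) :
    torusDot m (fun x => (φ x : AddCircle (2 * π))) = (zdot m φ : ℝ) := by
  change ∑ x, m x • Angle.coeHom (φ x) = Angle.coeHom (∑ x, (m x : ℝ) * φ x)
  simp only [map_sum, ← zsmul_eq_mul, map_zsmul]

/-- The product of cosines in `integral_prod_cos_pm_nonneg`, seen as a function of a pair of points
of the torus `(ℝ/2πℤ)^Λ`. -/
noncomputable def torusProd {Λ : Type*} [Fintype Λ] {n : ℕ} (M : Fin n → Λ → ℤ) (ε : Fin n → ℝ)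
    (z : (Λ → AddCircle (2 * π)) × (Λ → AddCircle (2 * π))) : ℝ :=
  ∏ s : Fin n, (Angle.cos (torusDot (M s) z.1) + ε s * Angle.cos (torusDot (M s) z.2))

theorem continuous_torusProd {Λ : Type*} [Fintype Λ] {n : ℕ} (M : Fin n → Λ → ℤ)
    (ε : Fin n → ℝ) : Continuous (torusProd M ε) :=
  have h (s : Fin n) := Angle.continuous_cos.comp (continuous_torusDot (M s))
  continuous_finsetProd _ fun s _ =>
    ((h s).comp continuous_fst).add (continuous_const.mul ((h s).comp continuous_snd))

theorem torusProd_coe {Λ : Type*} [Fintype Λ] {n : ℕ} (M : Fin n → Λ → ℤ) (ε : Fin n → ℝ)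
    (φ ψ : Λ → ℝ) :
    torusProd M ε (fun x => (φ x : AddCircle (2 * π)), fun x => (ψ x : AddCircle (2 * π))) =
      ∏ s : Fin n, (Real.cos (zdot (M s) φ) + ε s * Real.cos (zdot (M s) ψ)) := by
  simp only [torusProd, torusDot_coe, Angle.cos_coe]

/-- The endomorphism `(a, b) ↦ (a - b, a + b)` of `G × G`. -/
def subAddHom (G : Type*) [AddCommGroup G] : G × G →+ G × G :=
  (AddMonoidHom.fst G G - AddMonoidHom.snd G G).prod (AddMonoidHom.fst G G + AddMonoidHom.snd G G)

theorem subAddHom_surjective {G : Type*} [AddCommGroup G] (h : ∀ g : G, ∃ c, c + c = g) :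
    Function.Surjective (subAddHom G) := by
  rintro ⟨u, v⟩
  obtain ⟨c, hc⟩ := h (v - u)
  refine ⟨(u + c, c), Prod.ext ?_ ?_⟩
  · simp [subAddHom]
  · simp [subAddHom, add_assoc, hc]

theorem exists_add_self_eq_torus {Λ : Type*} (θ : Λ → AddCircle (2 * π)) : ∃ c, c + c = θ := by
  have h (x : Λ) : ∃ c : AddCircle (2 * π), c + c = θ x := by
    obtain ⟨r, hr⟩ := QuotientAddGroup.mk_surjective (θ x)
    exact ⟨(r / 2 : ℝ), by rw [← AddCircle.coe_add, add_halves]; exact hr⟩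
  choose c hc using h
  exact ⟨c, funext hc⟩

/-- In the variables `a = (φ + ψ) / 2`, `b = (ψ - φ) / 2` the product factorizes. -/
theorem torusProd_subAddHom {Λ : Type*} [Fintype Λ] {n : ℕ} (M : Fin n → Λ → ℤ)
    (ε : Fin n → ℝ) (hε : ∀ s, ε s = 1 ∨ ε s = -1) :
    ∃ F : (Λ → AddCircle (2 * π)) → ℝ,
      ∀ a b, torusProd M ε (subAddHom _ (a, b)) = 2 ^ n * (F a * F b) := by
  refine ⟨fun a => ∏ s, if ε s = 1 then Angle.cos (torusDot (M s) a)
    else Angle.sin (torusDot (M s) a), fun a b => ?_⟩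
  rw [← Finset.prod_mul_distrib, ← Fin.prod_const, ← Finset.prod_mul_distrib]
  refine Finset.prod_congr rfl fun s _ => ?_
  change Angle.cos (torusDot (M s) (a - b)) + ε s * Angle.cos (torusDot (M s) (a + b)) = _
  rw [map_sub, map_add, sub_eq_add_neg, Angle.cos_add, Angle.cos_add, Angle.cos_neg,
    Angle.sin_neg]
  rcases hε s with h | h
  · simp only [h, if_true]
    ring
  · have : (-1 : ℝ) ≠ 1 := by norm_num
    simp only [h, this, if_false]
    ring

theorem measurePreserving_coe_xyBox (Λ : Type*) [Fintype Λ] [Fact (0 < 2 * π)] :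
    MeasurePreserving (fun (φ : Λ → ℝ) x => (φ x : AddCircle (2 * π)))
      (volume.restrict (xyBox Λ)) volume := by
  have h := measurePreserving_pi _ _ fun _ : Λ => AddCircle.measurePreserving_mk (2 * π) 0
  rwa [zero_add, Measure.restrict_congr_set Ioc_ae_eq_Icc, ← Measure.restrict_pi_pi] at h

theorem integral_torusProd_nonneg {Λ : Type*} [Fintype Λ] [Fact (0 < 2 * π)] {n : ℕ}
    (M : Fin n → Λ → ℤ) (ε : Fin n → ℝ) (hε : ∀ s, ε s = 1 ∨ ε s = -1) :
    0 ≤ ∫ z, torusProd M ε z ∂(volume.prod volume) := by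
  have : BorelSpace ((Λ → AddCircle (2 * π)) × (Λ → AddCircle (2 * π))) := Prod.borelSpace
  have : Measure.IsAddHaarMeasure ((volume : Measure (Λ → AddCircle (2 * π))).prod
      (volume : Measure (Λ → AddCircle (2 * π)))) := Measure.prod.instIsAddHaarMeasure _ _
  have hc : Continuous (subAddHom (Λ → AddCircle (2 * π))) :=
    (continuous_fst.sub continuous_snd).prodMk (continuous_fst.add continuous_snd)
  have hp : MeasurePreserving (subAddHom (Λ → AddCircle (2 * π))) (volume.prod volume)
      (volume.prod volume) :=
    AddMonoidHom.measurePreserving hc (subAddHom_surjective exists_add_self_eq_torus) rfl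
  obtain ⟨F, hF⟩ := torusProd_subAddHom M ε hε
  rw [← hp.map_eq, integral_map hc.aemeasurable
    (continuous_torusProd M ε).aestronglyMeasurable]
  have h (z : (Λ → AddCircle (2 * π)) × (Λ → AddCircle (2 * π))) :
      torusProd M ε (subAddHom _ z) = 2 ^ n * (F z.1 * F z.2) := hF z.1 z.2
  simp_rw [h]
  rw [integral_const_mul, integral_prod_mul]
  exact mul_nonneg (by positivity) (mul_self_nonneg _)

/-- The double integral over `[0,2π]^Λ × [0,2π]^Λ` of any product
`∏_s (cos(M_s·φ) + ε_s cos(M_s·φ̄))` with signs `ε_s = ±1` is nonnegative. -/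
theorem integral_prod_cos_pm_nonneg {Λ : Type*} [Fintype Λ] (n : ℕ)
    (M : Fin n → Λ → ℤ) (ε : Fin n → ℝ) (hε : ∀ s : Fin n, ε s = 1 ∨ ε s = -1) :
    0 ≤ ∫ φ in xyBox Λ, ∫ ψ in xyBox Λ,
        ∏ s : Fin n, (Real.cos (zdot (M s) φ) + ε s * Real.cos (zdot (M s) ψ)) := by
  have : Fact (0 < 2 * π) := ⟨Real.two_pi_pos⟩
  have hmk := measurePreserving_coe_xyBox Λ
  have hG := continuous_torusProd M ε
  have hint : Integrable (torusProd M ε) (volume.prod volume) :=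
    hG.integrable_of_hasCompactSupport (HasCompactSupport.of_compactSpace _)
  have h := integral_torusProd_nonneg M ε hε
  rw [integral_prod _ hint, ← hmk.map_eq, integral_map hmk.measurable.aemeasurable
    hG.stronglyMeasurable.integral_prod_right'.aestronglyMeasurable] at h
  refine h.trans_eq (integral_congr_ae (.of_forall fun φ => ?_))
  refine (integral_map (f := fun y => torusProd M ε (fun x => (φ x : AddCircle (2 * π)), y))
    hmk.measurable.aemeasurable
    (hG.comp (Continuous.prodMk_right _)).aestronglyMeasurable).trans ?_
  simp only [torusProd_coe]
end
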